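/- arXiv:1005.3107 — 3 statements merged into one kernel-verified Lean document; each statement's English description precedes it below -/
import Mathlib

section
/- There exists a constant C > 0 (depending only on q and H) such that for every n ≥ 1 and every twice continuously differentiable function h : ℝ → ℝ with bounded second derivative, |E[h(S_n)] − E[h(S)]| ≤ C ‖h''‖_∞ φ(n), where, setting a = 2H−2, φ(n) = n^{−1/2} if a ∈ (−2,−1], φ(n) = n^{a/2} if a ∈ [−1, −1/(q−1)], and φ(n) = n^{(aq+1)/2} if a ∈ [−1/(q−1), −1/q). -/
open MeasureTheory ProbabilityTheory Filter
open scoped BigOperators NNReal Topology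

noncomputable section

/-- The `n`-th (probabilists') Hermite polynomial, evaluated at `x`. -/
def Hev (n : ℕ) (x : ℝ) : ℝ := Polynomial.aeval x (Polynomial.hermite n)

/-- The covariance function of the fractional Gaussian noise of Hurst index `H`. -/
def rH (H : ℝ) (j : ℤ) : ℝ :=
  (1 / 2) * (|(j : ℝ) + 1| ^ (2 * H) - 2 * |(j : ℝ)| ^ (2 * H) + |(j : ℝ) - 1| ^ (2 * H))

/-- The normalized partial sums of the Hermite-subordinated sequence. -/
def S1 {Ω : Type} [MeasureSpace Ω] (q : ℕ) (X : ℤ → Ω → ℝ) (n : ℕ) (ω : Ω) : ℝ :=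
  (Real.sqrt n)⁻¹ * ∑ k ∈ Finset.Icc (1 : ℤ) n, Hev q (X k ω)

end

/-- Standing assumptions on the Gaussian sequence. -/
structure GP {Ω : Type} [MeasurableSpace Ω] (X : ℤ → Ω → ℝ) (r : ℤ → ℝ) (P : Measure Ω) :
    Prop where
  meas : ∀ k, Measurable (X k)
  gauss : ∀ (s : Finset ℤ) (c : ℤ → ℝ), ∃ v : ℝ≥0,
      Measure.map (fun ω => ∑ k ∈ s, c k * X k ω) P = gaussianReal 0 v
  cov : ∀ k l : ℤ, ∫ ω, X k ω * X l ω ∂P = r (l - k)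
  r0 : r 0 = 1

/-- One-dimensional Gaussian integration by parts. -/
lemma ibp1 (g g' : ℝ → ℝ) (hg : ∀ x, HasDerivAt g (g' x) x)
    (h1 : Integrable (fun x => x * g x) (gaussianReal 0 1)) (h2 : Integrable g (gaussianReal 0 1))
    (h3 : Integrable g' (gaussianReal 0 1)) :
    ∫ x, x * g x ∂(gaussianReal 0 1) = ∫ x, g' x ∂(gaussianReal 0 1) := by
  have key : ∀ f : ℝ → ℝ, Integrable f (gaussianReal 0 1) ↔
      Integrable (fun x => gaussianPDFReal 0 1 x * f x) := by
    intro f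
    rw [gaussianReal_of_var_ne_zero 0 one_ne_zero]
    rw [integrable_withDensity_iff_integrable_smul' (measurable_gaussianPDF 0 1)
      (ae_of_all _ fun x => gaussianPDF_lt_top)]
    simp [toReal_gaussianPDF]
  rw [key] at h1 h2 h3
  simp only [integral_gaussianReal_eq_integral_smul one_ne_zero, smul_eq_mul]
  have hv : ∀ x : ℝ, HasDerivAt (gaussianPDFReal 0 1) (-x * gaussianPDFReal 0 1 x) x := by
    intro x
    have : HasDerivAt (fun x : ℝ => (√(2 * Real.pi * ((1 : ℝ≥0) : ℝ)))⁻¹ *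
        Real.exp (-(x - 0) ^ 2 / (2 * ((1 : ℝ≥0) : ℝ))))
        (-x * gaussianPDFReal 0 1 x) x := by
      have h := (((((hasDerivAt_id x).sub_const 0).pow 2).neg.div_const
        (2 * ((1 : ℝ≥0) : ℝ))).exp).const_mul (√(2 * Real.pi * ((1 : ℝ≥0) : ℝ)))⁻¹
      refine h.congr_deriv ?_
      simp [gaussianPDFReal]
      ring
    exact this
  have := integral_mul_deriv_eq_deriv_mul_of_integrable (u := g) (v := gaussianPDFReal 0 1)
    (u' := g') (v' := fun x => -x * gaussianPDFReal 0 1 x) (fun x _ => hg x) (fun x _ => hv x)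
    ?_ ?_ ?_
  · have h4 : ∫ x, gaussianPDFReal 0 1 x * (x * g x) =
      - ∫ x, g x * (-x * gaussianPDFReal 0 1 x) := by
      rw [← integral_neg]
      congr 1; ext x; ring
    rw [h4, this, neg_neg]
    congr 1; ext x; ring
  · refine h1.neg.congr (ae_of_all _ fun x => ?_)
    simp; ring
  · refine h3.congr (ae_of_all _ fun x => ?_)
    simp; ring
  · refine h2.congr (ae_of_all _ fun x => ?_)
    simp; ring

section
variable {Ω : Type} [MeasurableSpace Ω] {P : Measure Ω} [IsProbabilityMeasure P]
  {X : ℤ → Ω → ℝ} {r : ℤ → ℝ}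

lemma GP.r_symm (h : GP X r P) (j : ℤ) : r (-j) = r j := by
  have h1 := h.cov 0 j
  have h2 := h.cov j 0
  simp only [sub_zero, zero_sub] at h1 h2
  rw [← h1, ← h2]
  congr 1; ext ω; ring

lemma GP.exists_map (h : GP X r P) (k : ℤ) : ∃ v : ℝ≥0, P.map (X k) = gaussianReal 0 v := by
  obtain ⟨v, hv⟩ := h.gauss {k} 1
  exact ⟨v, by simpa using hv⟩

lemma GP.memLp (h : GP X r P) (k : ℤ) (p : ℝ≥0) : MemLp (X k) p P := by
  obtain ⟨v, hv⟩ := h.exists_map k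
  have : MemLp id p (P.map (X k)) := hv ▸ memLp_id_gaussianReal p
  exact (memLp_map_measure_iff aestronglyMeasurable_id (h.meas k).aemeasurable).1 this

lemma GP.map_eq (h : GP X r P) (k : ℤ) : P.map (X k) = gaussianReal 0 1 := by
  obtain ⟨v, hv⟩ := h.exists_map k
  have h1 : ∫ x, x * x ∂(P.map (X k)) = 1 := by
    rw [integral_map (h.meas k).aemeasurable (by fun_prop)]
    rw [h.cov k k, sub_self, h.r0]
  have h2 : (v : ℝ) = 1 := by
    rw [← variance_fun_id_gaussianReal (μ := 0) (v := v), variance_eq_sub, ← hv]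
    · have : ∫ x, x ∂(P.map (X k)) = 0 := by rw [hv]; exact integral_id_gaussianReal
      rw [this, ← h1]
      simp only [Pi.pow_apply, pow_two]
      simp
    · exact memLp_id_gaussianReal 2
  have : v = 1 := by exact_mod_cast h2
  rw [hv, this]

lemma GP.integral_zero (h : GP X r P) (k : ℤ) : ∫ ω, X k ω ∂P = 0 := by
  have : ∫ x, x ∂(P.map (X k)) = 0 := by rw [h.map_eq k]; exact integral_id_gaussianReal
  rwa [integral_map (h.meas k).aemeasurable (by fun_prop)] at this

lemma GP.gaussian (h : GP X r P) : IsGaussianProcess X P where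
  hasGaussianLaw I := by
    have hm : Measurable (fun ω ↦ I.restrict (X · ω)) := by
      refine measurable_pi_lambda _ fun i => ?_
      exact h.meas i
    constructor
    constructor
    intro L
    let c : ℤ → ℝ := fun k => if hk : k ∈ I then L (Pi.single ⟨k, hk⟩ 1) else 0
    have hL : L ∘ (fun ω ↦ I.restrict (X · ω)) = fun ω => ∑ k ∈ I, c k * X k ω := by
      ext ω
      simp only [Function.comp]
      have hpi := L.toLinearMap.pi_apply_eq_sum_univ (I.restrict (X · ω))
      simp only [ContinuousLinearMap.coe_coe] at hpi
      rw [hpi, ← Finset.sum_coe_sort I]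
      refine Finset.sum_congr rfl fun i _ => ?_
      simp [c, mul_comm]
      left
      congr 1
      ext j
      simp [Pi.single_apply, eq_comm]
    obtain ⟨v, hv⟩ := h.gauss I c
    have hmap : (P.map (fun ω ↦ I.restrict (X · ω))).map L = gaussianReal 0 v := by
      rw [Measure.map_map L.continuous.measurable hm, hL, hv]
    have e1 : ∫ x, L x ∂(P.map (fun ω ↦ I.restrict (X · ω))) = 0 := by
      have := integral_map (μ := P.map (fun ω ↦ I.restrict (X · ω))) (φ := L) (f := id)
        L.continuous.measurable.aemeasurable aestronglyMeasurable_id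
      simp only [id] at this
      rw [← this, hmap]; exact integral_id_gaussianReal
    have e2 : Var[L; P.map (fun ω ↦ I.restrict (X · ω))] = v := by
      have := variance_map (μ := P.map (fun ω ↦ I.restrict (X · ω))) (Y := L) (X := id)
        aemeasurable_id L.continuous.measurable.aemeasurable
      rw [hmap, variance_id_gaussianReal] at this
      rw [this]; rfl
    rw [hmap, e1, e2, Real.toNNReal_coe]

/-- Finite linear combinations of a Gaussian family form a Gaussian family. -/
lemma gaussian_of_linear {S : Type} {Y : S → Ω → ℝ} (hX : IsGaussianProcess X P)
    (h : ∀ s, ∃ I : Finset ℤ, ∃ L : (I → ℝ) →L[ℝ] ℝ, ∀ ω, Y s ω = L (I.restrict (X · ω))) :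
    IsGaussianProcess Y P where
  hasGaussianLaw I := by
    choose J L hL using h
    classical
    let K : (I.biUnion J → ℝ) →L[ℝ] I → ℝ :=
      { toFun x s := L s (fun t ↦ x ⟨t.1, Finset.mem_biUnion.2 ⟨s.1, s.2, t.2⟩⟩)
        map_add' x y := by ext s; exact map_add (L s) _ _
        map_smul' c x := by ext s; exact map_smul (L s) c _ }
    have : (fun ω ↦ I.restrict (Y · ω)) = K ∘ (fun ω ↦ (I.biUnion J).restrict (X · ω)) := by
      ext; simp [K, hL, Finset.restrict_def]
    rw [this]
    exact (hX.hasGaussianLaw _).map _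

lemma GP.indep (h : GP X r P) (k : ℤ) :
    IndepFun (fun ω (l : ℤ) => X l ω - r (l - k) * X k ω) (X k) P := by
  have hg : IsGaussianProcess (Sum.elim (fun (l : ℤ) ω => X l ω - r (l - k) * X k ω)
      (fun (_ : Unit) => X k)) P := by
    refine gaussian_of_linear h.gaussian ?_
    rintro (l | u)
    · classical
      refine ⟨{l, k}, (ContinuousLinearMap.proj (R := ℝ) (φ := fun _ : ({l, k} : Finset ℤ) => ℝ)
        ⟨l, by simp⟩) - r (l - k) • (ContinuousLinearMap.proj (R := ℝ)
        (φ := fun _ : ({l, k} : Finset ℤ) => ℝ) ⟨k, by simp⟩), ?_⟩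
      intro ω; simp
    · refine ⟨{k}, ContinuousLinearMap.proj (R := ℝ) (φ := fun _ : ({k} : Finset ℤ) => ℝ)
        ⟨k, by simp⟩, ?_⟩
      intro ω; simp
  have := hg.indepFun_of_covariance_eq_zero
    (fun l => ((h.meas l).sub ((h.meas k).const_mul _)).aemeasurable)
    (fun _ => (h.meas k).aemeasurable) ?_
  · exact this.comp (φ := id) (ψ := fun f : Unit → ℝ => f ()) measurable_id
      (measurable_pi_apply _)
  · intro l _
    have m2 : ∀ j, MemLp (X j) 2 P := fun j => by exact_mod_cast h.memLp j 2
    have : (fun ω => X l ω - r (l - k) * X k ω) = X l - fun ω => r (l - k) * X k ω := rfl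
    rw [this, covariance_sub_left (m2 l) ((m2 k).const_mul _) (m2 k),
      covariance_const_mul_left, covariance_eq_sub (m2 l) (m2 k), covariance_eq_sub (m2 k) (m2 k)]
    simp only [Pi.mul_apply, h.cov, h.integral_zero, sub_self, h.r0]
    rw [show k - l = -(l - k) by ring, h.r_symm]
    ring

/-- Gaussian integration by parts for the sequence. -/
lemma GP.ibp (h : GP X r P) (k : ℤ) (G G' : (ℤ → ℝ) → ℝ) (hG : Measurable G) (hG' : Measurable G')
    (hd : ∀ (y : ℤ → ℝ) (z : ℝ), HasDerivAt (fun z : ℝ => G (fun l => y l + z * r (l - k)))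
      (G' (fun l => y l + z * r (l - k))) z)
    (i1 : Integrable (fun ω => X k ω * G (fun l => X l ω)) P)
    (i2 : Integrable (fun ω => G (fun l => X l ω)) P)
    (i3 : Integrable (fun ω => G' (fun l => X l ω)) P) :
    ∫ ω, X k ω * G (fun l => X l ω) ∂P = ∫ ω, G' (fun l => X l ω) ∂P := by
  set Y : Ω → ℤ → ℝ := fun ω (l : ℤ) => X l ω - r (l - k) * X k ω with hY
  have hYm : Measurable Y := measurable_pi_lambda _ fun l =>
    (h.meas l).sub ((h.meas k).const_mul _)
  have hj := (indepFun_iff_map_prod_eq_prod_map_map hYm.aemeasurable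
    (h.meas k).aemeasurable).1 (h.indep k)
  rw [h.map_eq k] at hj
  set μ := P.map Y
  have : IsProbabilityMeasure μ := Measure.isProbabilityMeasure_map hYm.aemeasurable
  have hpm : Measurable (fun ω => (Y ω, X k ω)) := hYm.prodMk (h.meas k)
  set T : (ℤ → ℝ) × ℝ → (ℤ → ℝ) := fun p l => p.1 l + p.2 * r (l - k) with hT
  have hTm : Measurable T := by
    refine measurable_pi_lambda _ fun l => ?_
    exact ((measurable_pi_apply l).comp measurable_fst).add (measurable_snd.mul_const _)
  have hTX : ∀ ω, T (Y ω, X k ω) = fun l => X l ω := by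
    intro ω; ext l; simp [T, Y]; ring
  have tr : ∀ f : (ℤ → ℝ) × ℝ → ℝ, Measurable f → Integrable (fun ω => f (Y ω, X k ω)) P →
      Integrable f (μ.prod (gaussianReal 0 1)) := by
    intro f hf hi
    rw [← hj]
    exact (integrable_map_measure hf.aestronglyMeasurable hpm.aemeasurable).2 hi
  have tr2 : ∀ f : (ℤ → ℝ) × ℝ → ℝ, Measurable f → ∫ ω, f (Y ω, X k ω) ∂P =
      ∫ p, f p ∂(μ.prod (gaussianReal 0 1)) := by
    intro f hf
    rw [← hj]
    exact (integral_map hpm.aemeasurable hf.aestronglyMeasurable).symm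
  have j1 := tr (fun p => p.2 * G (T p)) (measurable_snd.mul (hG.comp hTm)) (by simpa [hTX] using i1)
  have j2 := tr (fun p => G (T p)) (hG.comp hTm) (by simpa [hTX] using i2)
  have j3 := tr (fun p => G' (T p)) (hG'.comp hTm) (by simpa [hTX] using i3)
  have e1 := tr2 (fun p => p.2 * G (T p)) (measurable_snd.mul (hG.comp hTm))
  have e2 := tr2 (fun p => G' (T p)) (hG'.comp hTm)
  simp only [hTX] at e1 e2
  rw [e1, e2, integral_prod _ j1, integral_prod _ j3]
  refine integral_congr_ae ?_
  filter_upwards [j1.prod_right_ae, j2.prod_right_ae, j3.prod_right_ae] with y k1 k2 k3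
  exact ibp1 (fun z => G (T (y, z))) (fun z => G' (T (y, z))) (fun z => hd y z) k1 k2 k3
end

lemma derivative_hermite_succ (n : ℕ) :
    Polynomial.derivative (Polynomial.hermite (n + 1)) =
      ((n : Polynomial ℤ) + 1) * Polynomial.hermite n := by
  induction n with
  | zero => simp
  | succ n ih =>
    rw [Polynomial.hermite_succ (n + 1), Polynomial.derivative_sub, Polynomial.derivative_mul, ih,
      Polynomial.derivative_mul]
    have : Polynomial.derivative (Polynomial.hermite n) =
      Polynomial.X * Polynomial.hermite n - Polynomial.hermite (n + 1) := by
      rw [Polynomial.hermite_succ n]; ring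
    rw [this]
    simp
    ring

lemma Hev_zero (x : ℝ) : Hev 0 x = 1 := by simp [Hev]

lemma Hev_hasDerivAt (n : ℕ) (x : ℝ) : HasDerivAt (Hev n) (n * Hev (n - 1) x) x := by
  cases n with
  | zero =>
    have : Hev 0 = fun _ => 1 := by ext x; exact Hev_zero x
    rw [this]; simpa using hasDerivAt_const x (1 : ℝ)
  | succ n =>
    have := Polynomial.hasDerivAt_aeval (Polynomial.hermite (n + 1)) x
    rw [derivative_hermite_succ] at this
    refine this.congr_deriv ?_
    simp [Hev]

lemma Hev_succ (n : ℕ) (x : ℝ) : Hev (n + 1) x = x * Hev n x - n * Hev (n - 1) x := by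
  have h1 := Hev_hasDerivAt n x
  have h2 := Polynomial.hasDerivAt_aeval (Polynomial.hermite n) x
  have h3 := h1.unique h2
  rw [h3]
  simp [Hev, Polynomial.hermite_succ]

lemma Hev_continuous (n : ℕ) : Continuous (Hev n) :=
  continuous_iff_continuousAt.2 fun x => (Hev_hasDerivAt n x).continuousAt

/-- Membership in all Lebesgue spaces of finite exponent. -/
def AllLp {Ω : Type} [MeasurableSpace Ω] (P : Measure Ω) (f : Ω → ℝ) : Prop :=
  ∀ p : ℝ≥0, MemLp f p P

section
variable {Ω : Type} [MeasurableSpace Ω] {P : Measure Ω} [IsProbabilityMeasure P]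
  {X : ℤ → Ω → ℝ} {r : ℤ → ℝ} {f g : Ω → ℝ}

lemma AllLp.add (hf : AllLp P f) (hg : AllLp P g) : AllLp P (fun ω => f ω + g ω) :=
  fun p => (hf p).add (hg p)

lemma AllLp.sub (hf : AllLp P f) (hg : AllLp P g) : AllLp P (fun ω => f ω - g ω) :=
  fun p => (hf p).sub (hg p)

lemma AllLp.mul (hf : AllLp P f) (hg : AllLp P g) : AllLp P (fun ω => f ω * g ω) := by
  intro p
  have h1 := hf (2 * p)
  have h2 := hg (2 * p)
  have : ENNReal.HolderTriple ((2 * p : ℝ≥0) : ENNReal) ((2 * p : ℝ≥0) : ENNReal) (p : ENNReal) := by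
    constructor
    push_cast
    rw [ENNReal.mul_inv (by simp) (by simp), ← add_mul, ENNReal.inv_two_add_inv_two, one_mul]
  exact h2.mul h1

lemma AllLp.const (c : ℝ) : AllLp P (fun _ => c) := fun _ => memLp_const c

lemma AllLp.integrable (hf : AllLp P f) : Integrable f P := by
  have := hf 1
  simpa [memLp_one_iff_integrable] using this

lemma AllLp.sum {ι : Type} (s : Finset ι) (F : ι → Ω → ℝ) (h : ∀ i ∈ s, AllLp P (F i)) :
    AllLp P (fun ω => ∑ i ∈ s, F i ω) := fun p => memLp_finsetSum s fun i hi => h i hi p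

lemma AllLp.mono (hf : AllLp P f) (hg : AEStronglyMeasurable g P) (h : ∀ ω, |g ω| ≤ |f ω|) :
    AllLp P g := fun p => (hf p).mono hg (ae_of_all _ h)

lemma AllLp.abs (hf : AllLp P f) : AllLp P (fun ω => |f ω|) := fun p => (hf p).abs

lemma GP.allLp (h : GP X r P) (k : ℤ) : AllLp P (X k) := fun p => h.memLp k p

lemma GP.allLp_hev (h : GP X r P) (n : ℕ) (k : ℤ) : AllLp P (fun ω => Hev n (X k ω)) := by
  induction n using Nat.strong_induction_on with
  | _ n ih =>
    cases n with
    | zero => simpa [Hev_zero] using AllLp.const (P := P) 1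
    | succ n =>
      simp only [Hev_succ]
      refine ((h.allLp k).mul (ih n (by lia))).sub ?_
      exact (AllLp.const _).mul (ih (n - 1) (by lia))

/-- Integration by parts against a Hermite polynomial. -/
lemma GP.hstep (h : GP X r P) (k : ℤ) (a : ℕ) (G G' : (ℤ → ℝ) → ℝ) (hG : Measurable G)
    (hG' : Measurable G')
    (hd : ∀ (y : ℤ → ℝ) (z : ℝ), HasDerivAt (fun z : ℝ => G (fun l => y l + z * r (l - k)))
      (G' (fun l => y l + z * r (l - k))) z)
    (i1 : AllLp P (fun ω => G (fun l => X l ω)))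
    (i2 : AllLp P (fun ω => G' (fun l => X l ω))) :
    ∫ ω, Hev (a + 1) (X k ω) * G (fun l => X l ω) ∂P =
      ∫ ω, Hev a (X k ω) * G' (fun l => X l ω) ∂P := by
  have hk : Measurable (fun x : ℤ → ℝ => x k) := measurable_pi_apply k
  have m1 : ∀ b, Measurable (fun x : ℤ → ℝ => Hev b (x k)) := fun b =>
    (Hev_continuous b).measurable.comp hk
  have hL := fun b => h.allLp_hev b k
  have j3 : AllLp P (fun ω => (a * Hev (a - 1) (X k ω)) * G (fun l => X l ω)) :=
    ((AllLp.const _).mul (hL (a - 1))).mul i1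
  have j4 : AllLp P (fun ω => Hev a (X k ω) * G' (fun l => X l ω)) := (hL a).mul i2
  have j5 : AllLp P (fun ω => X k ω * (Hev a (X k ω) * G (fun l => X l ω))) :=
    (h.allLp k).mul ((hL a).mul i1)
  have key := h.ibp k (fun x => Hev a (x k) * G x)
    (fun x => (a * Hev (a - 1) (x k)) * G x + Hev a (x k) * G' x)
    ((m1 a).mul hG) ((((m1 (a - 1)).const_mul _).mul hG).add ((m1 a).mul hG')) ?_
    j5.integrable ((hL a).mul i1).integrable (j3.add j4).integrable
  · rw [integral_add j3.integrable j4.integrable] at key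
    have : ∫ ω, Hev (a + 1) (X k ω) * G (fun l => X l ω) ∂P =
      ∫ ω, X k ω * (Hev a (X k ω) * G (fun l => X l ω)) ∂P -
      ∫ ω, (a * Hev (a - 1) (X k ω)) * G (fun l => X l ω) ∂P := by
      rw [← integral_sub j5.integrable j3.integrable]
      congr 1; ext ω; rw [Hev_succ]; ring
    rw [this, key]; ring
  · intro y z
    have h1 : HasDerivAt (fun z : ℝ => y k + z * r (k - k)) 1 z := by
      rw [sub_self, h.r0]
      simpa using (hasDerivAt_id z).const_add (y k)
    have h2 := (Hev_hasDerivAt a (y k + z * r (k - k))).comp z h1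
    have h3 := h2.mul (hd y z)
    refine h3.congr_deriv ?_
    simp

end

/-- Fourfold mixed Hermite moments. -/
noncomputable def M4 {Ω : Type} [MeasurableSpace Ω] (P : Measure Ω) (X : ℤ → Ω → ℝ) (i j k l : ℤ)
    (a b c d : ℕ) : ℝ :=
  ∫ ω, Hev a (X i ω) * (Hev b (X j ω) * (Hev c (X k ω) * Hev d (X l ω))) ∂P

section
variable {Ω : Type} [MeasurableSpace Ω] {P : Measure Ω} [IsProbabilityMeasure P]
  {X : ℤ → Ω → ℝ} {r : ℤ → ℝ}

lemma GP.M4_step (h : GP X r P) (i j k l : ℤ) (a b c d : ℕ) :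
    M4 P X i j k l (a + 1) b c d =
      b * r (j - i) * M4 P X i j k l a (b - 1) c d + c * r (k - i) * M4 P X i j k l a b (c - 1) d
        + d * r (l - i) * M4 P X i j k l a b c (d - 1) := by
  have m1 : ∀ b k, Measurable (fun x : ℤ → ℝ => Hev b (x k)) := fun b k =>
    (Hev_continuous b).measurable.comp (measurable_pi_apply k)
  have hL := fun b k => h.allLp_hev b k
  have key := h.hstep i a (fun x => Hev b (x j) * (Hev c (x k) * Hev d (x l)))
    (fun x => (b * r (j - i)) * (Hev (b - 1) (x j) * (Hev c (x k) * Hev d (x l))) +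
      (c * r (k - i)) * (Hev b (x j) * (Hev (c - 1) (x k) * Hev d (x l))) +
      (d * r (l - i)) * (Hev b (x j) * (Hev c (x k) * Hev (d - 1) (x l))))
    ((m1 _ _).mul ((m1 _ _).mul (m1 _ _)))
    (((((m1 _ _).mul ((m1 _ _).mul (m1 _ _))).const_mul _).add
      (((m1 _ _).mul ((m1 _ _).mul (m1 _ _))).const_mul _)).add
      (((m1 _ _).mul ((m1 _ _).mul (m1 _ _))).const_mul _)) ?_
    ((hL _ _).mul ((hL _ _).mul (hL _ _)))
    ((((AllLp.const _).mul ((hL _ _).mul ((hL _ _).mul (hL _ _)))).add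
      ((AllLp.const _).mul ((hL _ _).mul ((hL _ _).mul (hL _ _))))).add
      ((AllLp.const _).mul ((hL _ _).mul ((hL _ _).mul (hL _ _)))))
  · have I : ∀ a b c d, Integrable (fun ω =>
        Hev a (X i ω) * (Hev b (X j ω) * (Hev c (X k ω) * Hev d (X l ω)))) P := fun a b c d =>
      ((hL a i).mul ((hL b j).mul ((hL c k).mul (hL d l)))).integrable
    unfold M4
    rw [key]
    rw [← integral_const_mul, ← integral_const_mul, ← integral_const_mul, ← integral_add,
      ← integral_add]
    · congr 1; ext ω; ring
    · exact ((I _ _ _ _).const_mul _).add ((I _ _ _ _).const_mul _)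
    · exact (I _ _ _ _).const_mul _
    · exact (I _ _ _ _).const_mul _
    · exact (I _ _ _ _).const_mul _
  · intro y z
    have h1 : ∀ m : ℤ, HasDerivAt (fun z : ℝ => y m + z * r (m - i)) (r (m - i)) z := by
      intro m
      simpa using ((hasDerivAt_id z).mul_const (r (m - i))).const_add (y m)
    have h2 : ∀ (b : ℕ) (m : ℤ), HasDerivAt (fun z : ℝ => Hev b (y m + z * r (m - i)))
        (b * Hev (b - 1) (y m + z * r (m - i)) * r (m - i)) z :=
      fun b m => by
        have := (Hev_hasDerivAt b (y m + z * r (m - i))).comp z (h1 m)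
        exact this
    have h3 := (h2 b j).mul ((h2 c k).mul (h2 d l))
    refine h3.congr_deriv ?_
    simp only [Pi.mul_apply]
    ring

lemma GP.M4_zero (h : GP X r P) (i j k l : ℤ) : M4 P X i j k l 0 0 0 0 = 1 := by
  simp [M4, Hev_zero]

lemma GP.mstep (h : GP X r P) (N : ℕ) (a b c d : ℕ) (hN : a + 1 + b + c + d = N)
    (ih : ∀ a b c d, a + b + c + d < N → ∃ C : ℝ, 0 ≤ C ∧ ∀ (i j k l : ℤ) (w K : ℝ), 0 ≤ w → 
      0 ≤ K → (∀ e1 e2 e3 e4 e5 e6 : ℕ, e1 + e2 + e3 = a → e1 + e4 + e5 = b → e2 + e4 + e6 = c →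
        e3 + e5 + e6 = d → w * (|r (j - i)| ^ e1 * |r (k - i)| ^ e2 * |r (l - i)| ^ e3 *
          |r (k - j)| ^ e4 * |r (l - j)| ^ e5 * |r (l - k)| ^ e6) ≤ K) →
        w * |M4 P X i j k l a b c d| ≤ C * K) :
    ∃ C : ℝ, 0 ≤ C ∧ ∀ (i j k l : ℤ) (w K : ℝ), 0 ≤ w → 0 ≤ K →
      (∀ e1 e2 e3 e4 e5 e6 : ℕ, e1 + e2 + e3 = a + 1 → e1 + e4 + e5 = b → e2 + e4 + e6 = c →
        e3 + e5 + e6 = d → w * (|r (j - i)| ^ e1 * |r (k - i)| ^ e2 * |r (l - i)| ^ e3 *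
          |r (k - j)| ^ e4 * |r (l - j)| ^ e5 * |r (l - k)| ^ e6) ≤ K) →
        w * |M4 P X i j k l (a + 1) b c d| ≤ C * K := by
  obtain ⟨C1, hC1, H1⟩ := ih a (b - 1) c d (by lia)
  obtain ⟨C2, hC2, H2⟩ := ih a b (c - 1) d (by lia)
  obtain ⟨C3, hC3, H3⟩ := ih a b c (d - 1) (by lia)
  refine ⟨b * C1 + c * C2 + d * C3, by positivity, ?_⟩
  intro i j k l w K hw hK hyp
  rw [h.M4_step]
  have t1 : b * (w * |r (j - i)| * |M4 P X i j k l a (b - 1) c d|) ≤ b * (C1 * K) := by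
    rcases Nat.eq_zero_or_pos b with hb | hb
    · simp [hb]
    refine mul_le_mul_of_nonneg_left (H1 i j k l _ K (by positivity) hK ?_) (by positivity)
    intro e1 e2 e3 e4 e5 e6 q1 q2 q3 q4
    refine le_trans (le_of_eq ?_) (hyp (e1 + 1) e2 e3 e4 e5 e6 (by lia) (by lia) (by lia) (by lia))
    ring
  have t2 : c * (w * |r (k - i)| * |M4 P X i j k l a b (c - 1) d|) ≤ c * (C2 * K) := by
    rcases Nat.eq_zero_or_pos c with hb | hb
    · simp [hb]
    refine mul_le_mul_of_nonneg_left (H2 i j k l _ K (by positivity) hK ?_) (by positivity)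
    intro e1 e2 e3 e4 e5 e6 q1 q2 q3 q4
    refine le_trans (le_of_eq ?_) (hyp e1 (e2 + 1) e3 e4 e5 e6 (by lia) (by lia) (by lia) (by lia))
    ring
  have t3 : d * (w * |r (l - i)| * |M4 P X i j k l a b c (d - 1)|) ≤ d * (C3 * K) := by
    rcases Nat.eq_zero_or_pos d with hb | hb
    · simp [hb]
    refine mul_le_mul_of_nonneg_left (H3 i j k l _ K (by positivity) hK ?_) (by positivity)
    intro e1 e2 e3 e4 e5 e6 q1 q2 q3 q4
    refine le_trans (le_of_eq ?_) (hyp e1 e2 (e3 + 1) e4 e5 e6 (by lia) (by lia) (by lia) (by lia))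
    ring
  have t0 := abs_add_three (b * r (j - i) * M4 P X i j k l a (b - 1) c d)
    (c * r (k - i) * M4 P X i j k l a b (c - 1) d) (d * r (l - i) * M4 P X i j k l a b c (d - 1))
  simp only [abs_mul, Nat.abs_cast] at t0
  have t4 := mul_le_mul_of_nonneg_left t0 hw
  linarith

lemma GP.mbound (h : GP X r P) (N : ℕ) : ∀ a b c d : ℕ, a + b + c + d = N →
    ∃ C : ℝ, 0 ≤ C ∧ ∀ (i j k l : ℤ) (w K : ℝ), 0 ≤ w → 0 ≤ K →
      (∀ e1 e2 e3 e4 e5 e6 : ℕ, e1 + e2 + e3 = a → e1 + e4 + e5 = b → e2 + e4 + e6 = c →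
        e3 + e5 + e6 = d → w * (|r (j - i)| ^ e1 * |r (k - i)| ^ e2 * |r (l - i)| ^ e3 *
          |r (k - j)| ^ e4 * |r (l - j)| ^ e5 * |r (l - k)| ^ e6) ≤ K) →
        w * |M4 P X i j k l a b c d| ≤ C * K := by
  induction N using Nat.strong_induction_on with
  | _ N IH =>
  have ih : ∀ a b c d, a + b + c + d < N → ∃ C : ℝ, 0 ≤ C ∧ ∀ (i j k l : ℤ) (w K : ℝ), 0 ≤ w → 
      0 ≤ K → (∀ e1 e2 e3 e4 e5 e6 : ℕ, e1 + e2 + e3 = a → e1 + e4 + e5 = b → e2 + e4 + e6 = c →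
        e3 + e5 + e6 = d → w * (|r (j - i)| ^ e1 * |r (k - i)| ^ e2 * |r (l - i)| ^ e3 *
          |r (k - j)| ^ e4 * |r (l - j)| ^ e5 * |r (l - k)| ^ e6) ≤ K) →
        w * |M4 P X i j k l a b c d| ≤ C * K := fun a b c d hlt => IH _ hlt a b c d rfl
  have sy : ∀ s t : ℤ, r (s - t) = r (t - s) := fun s t => by
    rw [← h.r_symm (t - s), neg_sub]
  intro a b c d hN
  rcases a with _ | a
  · rcases b with _ | b
    · rcases c with _ | c
      · rcases d with _ | d
        · refine ⟨1, zero_le_one, ?_⟩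
          intro i j k l w K hw hK hyp
          have := hyp 0 0 0 0 0 0 rfl rfl rfl rfl
          simpa [h.M4_zero] using this
        · obtain ⟨C, hC, HC⟩ := h.mstep N d 0 0 0 (by lia) ih
          refine ⟨C, hC, ?_⟩
          intro i j k l w K hw hK hyp
          have e : M4 P X i j k l 0 0 0 (d + 1) = M4 P X l j k i (d + 1) 0 0 0 := by
            unfold M4; congr 1; ext ω; ring
          rw [e]
          refine HC l j k i w K hw hK ?_
          intro e1 e2 e3 e4 e5 e6 q1 q2 q3 q4
          refine le_trans (le_of_eq ?_) (hyp e5 e6 e3 e4 e1 e2 (by lia) (by lia) (by lia) (by lia))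
          rw [sy j l, sy k l, sy i l, sy i j, sy i k]
          ring
      · obtain ⟨C, hC, HC⟩ := h.mstep N c 0 0 d (by lia) ih
        refine ⟨C, hC, ?_⟩
        intro i j k l w K hw hK hyp
        have e : M4 P X i j k l 0 0 (c + 1) d = M4 P X k j i l (c + 1) 0 0 d := by
          unfold M4; congr 1; ext ω; ring
        rw [e]
        refine HC k j i l w K hw hK ?_
        intro e1 e2 e3 e4 e5 e6 q1 q2 q3 q4
        refine le_trans (le_of_eq ?_) (hyp e4 e2 e6 e1 e5 e3 (by lia) (by lia) (by lia) (by lia))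
        rw [sy j k, sy i k, sy i j]
        ring
    · obtain ⟨C, hC, HC⟩ := h.mstep N b 0 c d (by lia) ih
      refine ⟨C, hC, ?_⟩
      intro i j k l w K hw hK hyp
      have e : M4 P X i j k l 0 (b + 1) c d = M4 P X j i k l (b + 1) 0 c d := by
        unfold M4; congr 1; ext ω; ring
      rw [e]
      refine HC j i k l w K hw hK ?_
      intro e1 e2 e3 e4 e5 e6 q1 q2 q3 q4
      refine le_trans (le_of_eq ?_) (hyp e1 e4 e5 e2 e3 e6 (by lia) (by lia) (by lia) (by lia))
      rw [sy i j]
      ring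
  · exact h.mstep N a b c d (by lia) ih

lemma GP.dbound (h : GP X r P) (c d : ℕ) (a : ℕ) :
    ∃ C : ℝ, 0 ≤ C ∧ ∀ (i j k l : ℤ) (w K : ℝ), 0 ≤ w → 0 ≤ K →
      (∀ e1 e2 e3 e4 e5 e6 : ℕ, e1 + e2 + e3 = a → e1 + e4 + e5 = a → e2 + e4 + e6 = c →
        e3 + e5 + e6 = d → 1 ≤ e2 + e3 →
        w * (|r (j - i)| ^ e1 * |r (k - i)| ^ e2 * |r (l - i)| ^ e3 *
          |r (k - j)| ^ e4 * |r (l - j)| ^ e5 * |r (l - k)| ^ e6) ≤ K) →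
        w * |M4 P X i j k l a a c d - M4 P X i j k l a a 0 0 * M4 P X i j k l 0 0 c d| ≤ C * K := by
  induction a with
  | zero =>
    refine ⟨0, le_rfl, ?_⟩
    intro i j k l w K hw hK _
    simp [h.M4_zero]
  | succ a ih =>
    obtain ⟨C1, hC1, H1⟩ := ih
    obtain ⟨C2, hC2, H2⟩ := h.mbound _ a (a + 1) (c - 1) d rfl
    obtain ⟨C3, hC3, H3⟩ := h.mbound _ a (a + 1) c (d - 1) rfl
    refine ⟨(a + 1 : ℕ) * C1 + c * C2 + d * C3, by positivity, ?_⟩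
    intro i j k l w K hw hK hyp
    have t1 : (a + 1 : ℕ) * (w * |r (j - i)| *
        |M4 P X i j k l a a c d - M4 P X i j k l a a 0 0 * M4 P X i j k l 0 0 c d|) ≤
        (a + 1 : ℕ) * (C1 * K) := by
      refine mul_le_mul_of_nonneg_left (H1 i j k l _ K (by positivity) hK ?_) (by positivity)
      intro e1 e2 e3 e4 e5 e6 q1 q2 q3 q4 q5
      refine le_trans (le_of_eq ?_)
        (hyp (e1 + 1) e2 e3 e4 e5 e6 (by lia) (by lia) (by lia) (by lia) (by lia))
      ring
    have t2 : c * (w * |r (k - i)| * |M4 P X i j k l a (a + 1) (c - 1) d|) ≤ c * (C2 * K) := by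
      rcases Nat.eq_zero_or_pos c with hb | hb
      · simp [hb]
      refine mul_le_mul_of_nonneg_left (H2 i j k l _ K (by positivity) hK ?_) (by positivity)
      intro e1 e2 e3 e4 e5 e6 q1 q2 q3 q4
      refine le_trans (le_of_eq ?_)
        (hyp e1 (e2 + 1) e3 e4 e5 e6 (by lia) (by lia) (by lia) (by lia) (by lia))
      ring
    have t3 : d * (w * |r (l - i)| * |M4 P X i j k l a (a + 1) c (d - 1)|) ≤ d * (C3 * K) := by
      rcases Nat.eq_zero_or_pos d with hb | hb
      · simp [hb]
      refine mul_le_mul_of_nonneg_left (H3 i j k l _ K (by positivity) hK ?_) (by positivity)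
      intro e1 e2 e3 e4 e5 e6 q1 q2 q3 q4
      refine le_trans (le_of_eq ?_)
        (hyp e1 e2 (e3 + 1) e4 e5 e6 (by lia) (by lia) (by lia) (by lia) (by lia))
      ring
    have e : M4 P X i j k l (a + 1) (a + 1) c d -
        M4 P X i j k l (a + 1) (a + 1) 0 0 * M4 P X i j k l 0 0 c d =
        (a + 1 : ℕ) * r (j - i) *
        (M4 P X i j k l a a c d - M4 P X i j k l a a 0 0 * M4 P X i j k l 0 0 c d) +
        c * r (k - i) * M4 P X i j k l a (a + 1) (c - 1) d +
        d * r (l - i) * M4 P X i j k l a (a + 1) c (d - 1) := by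
      rw [h.M4_step, h.M4_step i j k l a (a + 1) 0 0]
      simp only [Nat.add_sub_cancel]
      push_cast
      ring
    rw [e]
    have t0 := abs_add_three ((a + 1 : ℕ) * r (j - i) *
        (M4 P X i j k l a a c d - M4 P X i j k l a a 0 0 * M4 P X i j k l 0 0 c d))
      (c * r (k - i) * M4 P X i j k l a (a + 1) (c - 1) d)
      (d * r (l - i) * M4 P X i j k l a (a + 1) c (d - 1))
    simp only [abs_mul, Nat.abs_cast] at t0
    have t4 := mul_le_mul_of_nonneg_left t0 hw
    linarith

lemma GP.M2 (h : GP X r P) (p : ℕ) (i j k l : ℤ) :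
    M4 P X i j k l p p 0 0 = p.factorial * r (j - i) ^ p := by
  induction p with
  | zero => simp [h.M4_zero]
  | succ p ih =>
    rw [h.M4_step, Nat.add_sub_cancel, ih, Nat.factorial_succ]
    push_cast; ring

lemma aux_uv {u v : ℝ} (hu : 0 ≤ u) (hv : 0 ≤ v) (A B p : ℕ) (hAB : A + B + 1 = p) :
    u ^ (A + 1) * v ^ (B + 1) ≤ u * v ^ p + u ^ p * v := by
  subst hAB
  have h1 : u ^ A * v ^ B ≤ u ^ (A + B) + v ^ (A + B) := by
    rw [pow_add, pow_add]
    rcases le_total u v with huv | huv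
    · have := mul_le_mul_of_nonneg_right (pow_le_pow_left₀ hu huv A) (pow_nonneg hv B)
      have : 0 ≤ u ^ A * u ^ B := by positivity
      linarith
    · have := mul_le_mul_of_nonneg_left (pow_le_pow_left₀ hv huv B) (pow_nonneg hu A)
      have : 0 ≤ v ^ A * v ^ B := by positivity
      linarith
  have h2 := mul_le_mul_of_nonneg_left h1 (mul_nonneg hu hv)
  calc u ^ (A + 1) * v ^ (B + 1) = u * v * (u ^ A * v ^ B) := by ring
    _ ≤ _ := h2
    _ = _ := by ring

lemma aux_vw {v w : ℝ} (hv : 0 ≤ v) (hw : 0 ≤ w) (A B : ℕ) :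
    v ^ A * w ^ B ≤ v ^ (A + B) ∨ v ^ A * w ^ B ≤ w ^ (A + B) := by
  rw [pow_add, pow_add]
  rcases le_total v w with huv | huv
  · right
    exact mul_le_mul_of_nonneg_right (pow_le_pow_left₀ hv huv A) (pow_nonneg hw B)
  · left
    exact mul_le_mul_of_nonneg_left (pow_le_pow_left₀ hw huv B) (pow_nonneg hv A)

lemma aux_uvw {u v w : ℝ} (hu : 0 ≤ u) (hv : 0 ≤ v) (hw : 0 ≤ w) (A B C p : ℕ)
    (h1 : A + B + C = p) (h2 : 1 ≤ B + C) :
    u ^ (A + 1) * (v ^ B * w ^ C) ≤ u * v ^ p + u ^ p * v + u * w ^ p + u ^ p * w := by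
  have n1 : 0 ≤ u * v ^ p + u ^ p * v := by positivity
  have n2 : 0 ≤ u * w ^ p + u ^ p * w := by positivity
  obtain ⟨D, hD⟩ := Nat.exists_eq_add_of_le' h2
  rcases aux_vw hv hw B C with h | h
  · have := mul_le_mul_of_nonneg_left h (pow_nonneg hu (A + 1))
    have h3 := aux_uv hu hv A D p (by lia)
    rw [hD] at this
    linarith
  · have := mul_le_mul_of_nonneg_left h (pow_nonneg hu (A + 1))
    have h3 := aux_uv hu hw A D p (by lia)
    rw [hD] at this
    linarith

/-- The covariance bound. -/
lemma GP.covbound (h : GP X r P) (p : ℕ) :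
    ∃ C : ℝ, 0 ≤ C ∧ ∀ (i j k l : ℤ),
      |r (j - i) * r (l - k) * (M4 P X i j k l p p p p -
        M4 P X i j k l p p 0 0 * M4 P X i j k l 0 0 p p)| ≤
      C * ((|r (j - i)| * |r (l - k)|) * (|r (k - i)| * |r (l - j)|) ^ p +
        (|r (j - i)| * |r (l - k)|) ^ p * (|r (k - i)| * |r (l - j)|) +
        (|r (j - i)| * |r (l - k)|) * (|r (l - i)| * |r (k - j)|) ^ p +
        (|r (j - i)| * |r (l - k)|) ^ p * (|r (l - i)| * |r (k - j)|)) := by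
  obtain ⟨C, hC, HC⟩ := h.dbound p p p
  refine ⟨C, hC, fun i j k l => ?_⟩
  rw [abs_mul, abs_mul]
  refine HC i j k l _ _ (by positivity) (by positivity) ?_
  intro e1 e2 e3 e4 e5 e6 q1 q2 q3 q4 q5
  have r1 : e6 = e1 := by lia
  have r2 : e5 = e2 := by lia
  have r3 : e4 = e3 := by lia
  subst r1 r2 r3
  refine le_trans (le_of_eq ?_) (aux_uvw (by positivity) (by positivity) (by positivity)
    e6 e5 e4 p (by lia) (by lia))
  simp only [mul_pow]
  ring

end

section
variable {Ω : Type} [MeasurableSpace Ω] {P : Measure Ω} [IsProbabilityMeasure P]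

lemma lip_bound {g g' : ℝ → ℝ} {C : ℝ} (hg : ∀ x, HasDerivAt g (g' x) x) (hC : ∀ x, |g' x| ≤ C)
    (x : ℝ) : |g x| ≤ |g 0| + C * |x| := by
  have := Convex.norm_image_sub_le_of_norm_hasDerivWithin_le (f := g) (f' := g') (s := Set.univ)
    (C := C) (x := 0) (y := x) (fun y _ => (hg y).hasDerivWithinAt) (fun y _ => hC y) convex_univ
    (Set.mem_univ _) (Set.mem_univ _)
  simp only [Real.norm_eq_abs, sub_zero] at this
  have h2 := abs_sub_abs_le_abs_sub (g x) (g 0)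
  linarith

lemma quad_bound {h h' h2 : ℝ → ℝ} {C : ℝ} (hh : ∀ x, HasDerivAt h (h' x) x)
    (hg : ∀ x, HasDerivAt h' (h2 x) x) (hC : ∀ x, |h2 x| ≤ C)
    (x : ℝ) : |h x| ≤ |h 0| + |h' 0| * |x| + C * |x| * |x| := by
  have hC0 : 0 ≤ C := (abs_nonneg _).trans (hC 0)
  have := Convex.norm_image_sub_le_of_norm_hasDerivWithin_le (f := h) (f' := h')
    (s := Set.Icc (-|x|) |x|)
    (C := |h' 0| + C * |x|) (x := 0) (y := x) (fun y _ => (hh y).hasDerivWithinAt)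
    (fun y hy => (lip_bound hg hC y).trans (by
      have : |y| ≤ |x| := abs_le.2 hy
      gcongr)) (convex_Icc _ _)
    (by simp) ⟨neg_abs_le x, le_abs_self x⟩
  simp only [Real.norm_eq_abs, sub_zero] at this
  have h2 := abs_sub_abs_le_abs_sub (h x) (h 0)
  linarith

lemma AllLp.fst {F : Ω → ℝ} (hF : AllLp P F) (ν : Measure ℝ) [IsProbabilityMeasure ν] :
    AllLp (P.prod ν) (fun z => F z.1) := fun p => (hF p).comp_fst ν

lemma allLp_snd (s : ℝ) : AllLp (P.prod (gaussianReal 0 1)) (fun z => s * z.2) := by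
  refine (AllLp.const s).mul fun p => ?_
  exact (memLp_id_gaussianReal (μ := 0) (v := 1) p).comp_snd P

/-- Abstract smart-path bound. -/
lemma smart_path (F Γ : Ω → ℝ) (hF : Measurable F) (hΓ : Measurable Γ) (aF : AllLp P F)
    (aΓ : AllLp P Γ) (v : ℝ≥0)
    (stein : ∀ (g g' : ℝ → ℝ) (C : ℝ), (∀ x, HasDerivAt g (g' x) x) → Continuous g' →
      (∀ x, |g' x| ≤ C) → ∫ ω, F ω * g (F ω) ∂P = ∫ ω, Γ ω * g' (F ω) ∂P)
    (h h' h2 : ℝ → ℝ) (C : ℝ) (hh : ∀ x, HasDerivAt h (h' x) x)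
    (hh' : ∀ x, HasDerivAt h' (h2 x) x) (hc : Continuous h2) (hC : ∀ x, |h2 x| ≤ C) :
    |(∫ ω, h (F ω) ∂P) - ∫ x, h x ∂(gaussianReal 0 v)| ≤ 2 * C * ∫ ω, |Γ ω - v| ∂P := by
  have hC0 : 0 ≤ C := (abs_nonneg _).trans (hC 0)
  have ch : Continuous h := continuous_iff_continuousAt.2 fun x => (hh x).continuousAt
  have ch' : Continuous h' := continuous_iff_continuousAt.2 fun x => (hh' x).continuousAt
  set s : ℝ := √(v : ℝ) with hs
  have hss : s * s = v := Real.mul_self_sqrt v.2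
  set Q := P.prod (gaussianReal 0 1) with hQ
  have aF' : AllLp Q (fun z => F z.1) := aF.fst _
  have aG' : AllLp Q (fun z => Γ z.1) := aΓ.fst _
  have aY : AllLp Q (fun z : Ω × ℝ => s * z.2) := allLp_snd s
  set Z : ℝ → Ω × ℝ → ℝ := fun θ z => Real.sin θ * F z.1 + Real.cos θ * (s * z.2) with hZ
  have mZ : ∀ θ, Measurable (Z θ) := fun θ =>
    ((hF.comp measurable_fst).const_mul _).add ((measurable_snd.const_mul _).const_mul _)
  have aZ : ∀ θ, AllLp Q (Z θ) := fun θ =>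
    ((AllLp.const _).mul aF').add ((AllLp.const _).mul aY)
  have aW : ∀ θ, AllLp Q (fun z => Real.cos θ * F z.1 - Real.sin θ * (s * z.2)) := fun θ =>
    ((AllLp.const _).mul aF').sub ((AllLp.const _).mul aY)
  have ah : ∀ θ, AllLp Q (fun z => h (Z θ z)) := fun θ =>
    (((AllLp.const |h 0|).add ((AllLp.const |h' 0|).mul (aZ θ).abs)).add
      (((AllLp.const C).mul (aZ θ).abs).mul (aZ θ).abs)).mono
      (ch.measurable.comp (mZ θ)).aestronglyMeasurable
      (fun z => (quad_bound hh hh' hC _).trans (le_abs_self _))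
  have ah' : ∀ θ, AllLp Q (fun z => h' (Z θ z)) := fun θ =>
    ((AllLp.const |h' 0|).add ((AllLp.const C).mul (aZ θ).abs)).mono
      (ch'.measurable.comp (mZ θ)).aestronglyMeasurable
      (fun z => (lip_bound hh' hC _).trans (le_abs_self _))
  have ah2 : ∀ θ, AllLp Q (fun z => h2 (Z θ z)) := fun θ =>
    (AllLp.const C).mono (hc.measurable.comp (mZ θ)).aestronglyMeasurable
      (fun z => (hC _).trans (le_abs_self _))
  -- the derivative
  have hder : ∀ θ, HasDerivAt (fun θ => ∫ z, h (Z θ z) ∂Q)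
      (∫ z, h' (Z θ z) * (Real.cos θ * F z.1 - Real.sin θ * (s * z.2)) ∂Q) θ := by
    intro θ
    refine (hasDerivAt_integral_of_dominated_loc_of_deriv_le (s := Set.univ) (μ := Q)
      (F := fun θ z => h (Z θ z))
      (F' := fun θ z => h' (Z θ z) * (Real.cos θ * F z.1 - Real.sin θ * (s * z.2)))
      (bound := fun z => (|h' 0| + C * (|F z.1| + |s * z.2|)) * (|F z.1| + |s * z.2|))
      Filter.univ_mem (Eventually.of_forall fun t =>
        (ch.measurable.comp (mZ t)).aestronglyMeasurable) (ah θ).integrable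
      ((ah' θ).mul (aW θ)).integrable.aestronglyMeasurable ?_ ?_ ?_).2
    · refine ae_of_all _ fun z t _ => ?_
      have e1 : |Real.sin t * F z.1| ≤ |F z.1| := by
        rw [abs_mul]; exact mul_le_of_le_one_left (abs_nonneg _) (Real.abs_sin_le_one t)
      have e2 : |Real.cos t * (s * z.2)| ≤ |s * z.2| := by
        rw [abs_mul]; exact mul_le_of_le_one_left (abs_nonneg _) (Real.abs_cos_le_one t)
      have e3 : |Real.cos t * F z.1| ≤ |F z.1| := by
        rw [abs_mul]; exact mul_le_of_le_one_left (abs_nonneg _) (Real.abs_cos_le_one t)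
      have e4 : |Real.sin t * (s * z.2)| ≤ |s * z.2| := by
        rw [abs_mul]; exact mul_le_of_le_one_left (abs_nonneg _) (Real.abs_sin_le_one t)
      have e5 : |Z t z| ≤ |F z.1| + |s * z.2| := (abs_add_le _ _).trans (add_le_add e1 e2)
      have e6 : |Real.cos t * F z.1 - Real.sin t * (s * z.2)| ≤ |F z.1| + |s * z.2| :=
        (abs_sub _ _).trans (add_le_add e3 e4)
      rw [Real.norm_eq_abs, abs_mul]
      refine mul_le_mul ((lip_bound hh' hC _).trans ?_) e6 (abs_nonneg _) (by positivity)
      gcongr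
    · exact (((AllLp.const _).add ((AllLp.const C).mul (aF'.abs.add aY.abs))).mul
        (aF'.abs.add aY.abs)).integrable
    · refine ae_of_all _ fun z t _ => ?_
      have d1 : HasDerivAt (fun t => Z t z) (Real.cos t * F z.1 + -Real.sin t * (s * z.2)) t :=
        ((Real.hasDerivAt_sin t).mul_const _).add ((Real.hasDerivAt_cos t).mul_const _)
      have := (hh (Z t z)).comp t d1
      refine this.congr_deriv ?_
      ring
  -- value of the derivative
  have i1 : ∀ θ, ∫ z, F z.1 * h' (Z θ z) ∂Q = Real.sin θ * ∫ z, Γ z.1 * h2 (Z θ z) ∂Q := by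
    intro θ
    rw [← integral_const_mul, hQ, integral_prod_symm _ (aF'.mul (ah' θ)).integrable,
      integral_prod_symm _ ((aG'.mul (ah2 θ)).integrable.const_mul _)]
    congr 1; ext x
    have := stein (fun t => h' (Real.sin θ * t + Real.cos θ * (s * x)))
      (fun t => Real.sin θ * h2 (Real.sin θ * t + Real.cos θ * (s * x))) C ?_ ?_ ?_
    · rw [this]; congr 1; ext ω; simp only [hZ]; ring
    · intro t
      have d1 : HasDerivAt (fun t => Real.sin θ * t + Real.cos θ * (s * x)) (Real.sin θ) t := by
        simpa using ((hasDerivAt_id t).const_mul (Real.sin θ)).add_const (Real.cos θ * (s * x))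
      have := (hh' _).comp t d1
      refine this.congr_deriv ?_
      ring
    · fun_prop
    · intro t
      rw [abs_mul]
      exact (mul_le_of_le_one_left (abs_nonneg _) (Real.abs_sin_le_one θ)).trans (hC _)
  have i2 : ∀ θ, ∫ z, (s * z.2) * h' (Z θ z) ∂Q = Real.cos θ * ∫ z, v * h2 (Z θ z) ∂Q := by
    intro θ
    have I1 : Integrable (fun z => (s * z.2) * h' (Z θ z)) Q := (aY.mul (ah' θ)).integrable
    have I2 : Integrable (fun z => v * h2 (Z θ z)) Q := ((AllLp.const _).mul (ah2 θ)).integrable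
    have I3 : Integrable (fun z : Ω × ℝ => z.2 * h' (Z θ z)) Q := by
      have a1 : AllLp Q (fun z : Ω × ℝ => 1 * z.2) := allLp_snd 1
      simp only [one_mul] at a1
      exact (a1.mul (ah' θ)).integrable
    have I4 : Integrable (fun z => h' (Z θ z)) Q := (ah' θ).integrable
    have I5 : Integrable (fun z => (Real.cos θ * s) * h2 (Z θ z)) Q :=
      (ah2 θ).integrable.const_mul _
    rw [← integral_const_mul, hQ, integral_prod _ I1, integral_prod _ (I2.const_mul _)]
    refine integral_congr_ae ?_
    filter_upwards [I3.prod_right_ae, I4.prod_right_ae, I5.prod_right_ae] with ω k1 k2 k3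
    have := ibp1 (fun x => h' (Z θ (ω, x))) (fun x => (Real.cos θ * s) * h2 (Z θ (ω, x))) ?_ k1 k2 k3
    · simp only [mul_assoc] at this ⊢
      rw [integral_const_mul, this, ← integral_const_mul]
      congr 1; ext x
      rw [← hss]; ring
    · intro x
      have d1 : HasDerivAt (fun x => Z θ (ω, x)) (Real.cos θ * s) x := by
        have := (((hasDerivAt_id x).const_mul s).const_mul (Real.cos θ)).const_add
          (Real.sin θ * F ω)
        exact this.congr_deriv (by simp)
      have := (hh' _).comp x d1
      refine this.congr_deriv ?_
      ring
  have val : ∀ θ, ∫ z, h' (Z θ z) * (Real.cos θ * F z.1 - Real.sin θ * (s * z.2)) ∂Q =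
      Real.cos θ * Real.sin θ * ∫ z, (Γ z.1 - v) * h2 (Z θ z) ∂Q := by
    intro θ
    have e1 : ∫ z, h' (Z θ z) * (Real.cos θ * F z.1 - Real.sin θ * (s * z.2)) ∂Q =
        Real.cos θ * (∫ z, F z.1 * h' (Z θ z) ∂Q) -
        Real.sin θ * ∫ z, (s * z.2) * h' (Z θ z) ∂Q := by
      rw [← integral_const_mul, ← integral_const_mul, ← integral_sub]
      · congr 1; ext z; ring
      · exact (aF'.mul (ah' θ)).integrable.const_mul _
      · exact (aY.mul (ah' θ)).integrable.const_mul _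
    have e2 : ∫ z, (Γ z.1 - v) * h2 (Z θ z) ∂Q = (∫ z, Γ z.1 * h2 (Z θ z) ∂Q) -
        ∫ z, v * h2 (Z θ z) ∂Q := by
      rw [← integral_sub]
      · congr 1; ext z; ring
      · exact (aG'.mul (ah2 θ)).integrable
      · exact ((AllLp.const _).mul (ah2 θ)).integrable
    rw [e1, i1, i2, e2]; ring
  have bd : ∀ θ, |∫ z, h' (Z θ z) * (Real.cos θ * F z.1 - Real.sin θ * (s * z.2)) ∂Q| ≤
      C * ∫ ω, |Γ ω - v| ∂P := by
    intro θ
    rw [val, abs_mul]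
    have e1 : |∫ z, (Γ z.1 - v) * h2 (Z θ z) ∂Q| ≤ C * ∫ ω, |Γ ω - v| ∂P := by
      have a1 : AllLp Q (fun z => Γ z.1 - v) := aG'.sub (AllLp.const _)
      calc |∫ z, (Γ z.1 - v) * h2 (Z θ z) ∂Q| ≤ ∫ z, |(Γ z.1 - v) * h2 (Z θ z)| ∂Q :=
            abs_integral_le_integral_abs
        _ ≤ ∫ z, C * |Γ z.1 - v| ∂Q := by
            refine integral_mono (a1.mul (ah2 θ)).integrable.abs (a1.integrable.abs.const_mul _) ?_
            intro z
            simp only [abs_mul]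
            rw [mul_comm]
            gcongr
            exact hC _
        _ = C * ∫ ω, |Γ ω - v| ∂P := by
            rw [integral_const_mul]
            congr 1
            have := integral_fun_fst (μ := P) (ν := gaussianReal 0 1) (fun ω => |Γ ω - v|)
            rw [hQ, this]; simp
    have e2 : |Real.cos θ * Real.sin θ| ≤ 1 := by
      rw [abs_mul]
      exact mul_le_one₀ (Real.abs_cos_le_one θ) (abs_nonneg _) (Real.abs_sin_le_one θ)
    exact (mul_le_of_le_one_left (abs_nonneg _) e2).trans e1
  have mv := Convex.norm_image_sub_le_of_norm_hasDerivWithin_le (s := Set.univ)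
    (x := 0) (y := Real.pi / 2) (fun θ _ => (hder θ).hasDerivWithinAt) (fun θ _ => bd θ)
    convex_univ (Set.mem_univ _) (Set.mem_univ _)
  have v1 : ∫ z, h (Z (Real.pi / 2) z) ∂Q = ∫ ω, h (F ω) ∂P := by
    have := integral_fun_fst (μ := P) (ν := gaussianReal 0 1) (fun ω => h (F ω))
    simp only [hZ, Real.sin_pi_div_two, Real.cos_pi_div_two, one_mul, zero_mul, add_zero]
    rw [hQ, this]; simp
  have v0 : ∫ z, h (Z 0 z) ∂Q = ∫ x, h x ∂(gaussianReal 0 v) := by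
    have := integral_fun_snd (μ := P) (ν := gaussianReal 0 1) (fun x => h (s * x))
    simp only [hZ, Real.sin_zero, Real.cos_zero, one_mul, zero_mul, zero_add]
    rw [hQ, this]
    have e : gaussianReal 0 v = (gaussianReal 0 1).map (fun x => s * x) := by
      rw [gaussianReal_map_const_mul]
      congr 1
      · simp
      · ext; simp [hs]
    rw [e, integral_map (by fun_prop) ch.aestronglyMeasurable]
    simp
  simp only [v1, v0, Real.norm_eq_abs, sub_zero] at mv
  refine mv.trans ?_
  have hI : 0 ≤ C * ∫ ω, |Γ ω - v| ∂P := mul_nonneg hC0 (integral_nonneg fun _ => abs_nonneg _)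
  have : |Real.pi / 2| ≤ 2 := by
    rw [abs_of_pos (by positivity)]
    linarith [Real.pi_le_four]
  nlinarith
end

/-- The normalized sum as a function of the path. -/
noncomputable def FF (p n : ℕ) (x : ℤ → ℝ) : ℝ :=
  (Real.sqrt n)⁻¹ * ∑ k ∈ Finset.Icc (1 : ℤ) n, Hev (p + 1) (x k)

/-- The carré-du-champ of the normalized sum. -/
noncomputable def GG (p n : ℕ) (r : ℤ → ℝ) (x : ℤ → ℝ) : ℝ :=
  ((p + 1 : ℝ) / n) * ∑ k ∈ Finset.Icc (1 : ℤ) n, ∑ l ∈ Finset.Icc (1 : ℤ) n,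
    r (l - k) * (Hev p (x k) * Hev p (x l))

section
variable {Ω : Type} [MeasurableSpace Ω] {P : Measure Ω} [IsProbabilityMeasure P]
  {X : ℤ → Ω → ℝ} {r : ℤ → ℝ}

lemma Hev_meas (b : ℕ) (k : ℤ) : Measurable (fun x : ℤ → ℝ => Hev b (x k)) :=
    (Hev_continuous b).measurable.comp (measurable_pi_apply k)

lemma FF_meas (p n : ℕ) : Measurable (FF p n) :=
  (Finset.measurable_fun_sum _ fun k _ => Hev_meas _ k).const_mul _

lemma GG_meas (p n : ℕ) (r : ℤ → ℝ) : Measurable (GG p n r) :=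
  (Finset.measurable_fun_sum _ fun k _ => Finset.measurable_fun_sum _ fun l _ =>
    ((Hev_meas _ k).mul (Hev_meas _ l)).const_mul _).const_mul _

lemma GP.meas_path (h : GP X r P) : Measurable (fun ω (l : ℤ) => X l ω) :=
  measurable_pi_lambda _ h.meas

lemma GP.FF_allLp (h : GP X r P) (p n : ℕ) : AllLp P (fun ω => FF p n (fun l => X l ω)) :=
  (AllLp.const _).mul (AllLp.sum _ _ fun k _ => h.allLp_hev _ k)

lemma GP.GG_allLp (h : GP X r P) (p n : ℕ) : AllLp P (fun ω => GG p n r (fun l => X l ω)) :=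
  (AllLp.const _).mul (AllLp.sum _ _ fun k _ => AllLp.sum _ _ fun l _ =>
    (AllLp.const _).mul ((h.allLp_hev _ k).mul (h.allLp_hev _ l)))

lemma GP.stein (h : GP X r P) (p n : ℕ) (g g' : ℝ → ℝ) (C : ℝ) 
    (hg : ∀ x, HasDerivAt g (g' x) x) (hc : Continuous g') (hC : ∀ x, |g' x| ≤ C) :
    ∫ ω, FF p n (fun l => X l ω) * g (FF p n (fun l => X l ω)) ∂P =
      ∫ ω, GG p n r (fun l => X l ω) * g' (FF p n (fun l => X l ω)) ∂P := by
  have cg : Continuous g := continuous_iff_continuousAt.2 fun x => (hg x).continuousAt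
  have ag : AllLp P (fun ω => g (FF p n (fun l => X l ω))) :=
    ((AllLp.const |g 0|).add ((AllLp.const C).mul (h.FF_allLp p n).abs)).mono
      (cg.measurable.comp ((FF_meas p n).comp h.meas_path)).aestronglyMeasurable
      (fun z => (lip_bound hg hC _).trans (le_abs_self _))
  have ag' : AllLp P (fun ω => g' (FF p n (fun l => X l ω))) :=
    (AllLp.const C).mono
      (hc.measurable.comp ((FF_meas p n).comp h.meas_path)).aestronglyMeasurable
      (fun z => (hC _).trans (le_abs_self _))
  set I := Finset.Icc (1 : ℤ) n
  have key : ∀ k, ∫ ω, Hev (p + 1) (X k ω) * g (FF p n (fun l => X l ω)) ∂P =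
      ∫ ω, Hev p (X k ω) * (g' (FF p n (fun l => X l ω)) * ((Real.sqrt n)⁻¹ *
        ∑ l ∈ I, (p + 1 : ℝ) * Hev p (X l ω) * r (l - k))) ∂P := by
    intro k
    refine h.hstep k p (fun x => g (FF p n x)) (fun x => g' (FF p n x) * ((Real.sqrt n)⁻¹ *
        ∑ l ∈ I, (p + 1 : ℝ) * Hev p (x l) * r (l - k))) (cg.measurable.comp (FF_meas p n))
        ((hc.measurable.comp (FF_meas p n)).mul ((Finset.measurable_fun_sum _ fun l _ =>
          ((Hev_meas _ l).const_mul _).mul_const _).const_mul _)) ?_ ag ?_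
    · intro y z
      have h1 : ∀ m : ℤ, HasDerivAt (fun z : ℝ => y m + z * r (m - k)) (r (m - k)) z := by
        intro m
        simpa using ((hasDerivAt_id z).mul_const (r (m - k))).const_add (y m)
      have h2 : ∀ m : ℤ, HasDerivAt (fun z : ℝ => Hev (p + 1) (y m + z * r (m - k)))
          ((p + 1 : ℝ) * Hev p (y m + z * r (m - k)) * r (m - k)) z := by
        intro m
        have := (Hev_hasDerivAt (p + 1) (y m + z * r (m - k))).comp z (h1 m)
        refine this.congr_deriv ?_
        simp
      have h3 := (HasDerivAt.fun_sum (u := I) fun m _ => h2 m).const_mul (Real.sqrt n)⁻¹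
      exact (hg _).comp z h3
    · exact ag'.mul ((AllLp.const _).mul (AllLp.sum _ _ fun l _ =>
        ((AllLp.const _).mul (h.allLp_hev _ l)).mul (AllLp.const _)))
  have e1 : ∫ ω, FF p n (fun l => X l ω) * g (FF p n (fun l => X l ω)) ∂P =
      (Real.sqrt n)⁻¹ * ∑ k ∈ I, ∫ ω, Hev (p + 1) (X k ω) * g (FF p n (fun l => X l ω)) ∂P := by
    rw [← integral_finset_sum, ← integral_const_mul]
    · congr 1; ext ω
      rw [← Finset.sum_mul, ← mul_assoc]
      rfl
    · intro k _
      exact ((h.allLp_hev _ k).mul ag).integrable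
  rw [e1]
  simp only [key]
  rw [← integral_finset_sum, ← integral_const_mul]
  · congr 1; ext ω
    have hn : (Real.sqrt n)⁻¹ * (Real.sqrt n)⁻¹ = (n : ℝ)⁻¹ := by
      rw [← mul_inv, Real.mul_self_sqrt (by positivity)]
    simp only [GG, div_eq_mul_inv, ← hn, Finset.mul_sum, Finset.sum_mul]
    refine Finset.sum_congr rfl fun k _ => Finset.sum_congr rfl fun l _ => ?_
    ring
  · intro k _
    exact ((h.allLp_hev _ k).mul (ag'.mul ((AllLp.const _).mul (AllLp.sum _ _ fun l _ =>
        ((AllLp.const _).mul (h.allLp_hev _ l)).mul (AllLp.const _))))).integrable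

lemma GP.intGG (h : GP X r P) (p n : ℕ) : ∫ ω, GG p n r (fun l => X l ω) ∂P =
    ((p + 1).factorial : ℝ) * ((n : ℝ)⁻¹ * ∑ k ∈ Finset.Icc (1 : ℤ) n, ∑ l ∈ Finset.Icc (1 : ℤ) n,
      r (l - k) ^ (p + 1)) := by
  have e : ∀ k l, ∫ ω, r (l - k) * (Hev p (X k ω) * Hev p (X l ω)) ∂P =
      p.factorial * r (l - k) ^ (p + 1) := by
    intro k l
    have := h.M2 p k l k l
    simp only [M4, Hev_zero, mul_one] at this
    rw [integral_const_mul, this]; ring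
  have I : ∀ k l, Integrable (fun ω => r (l - k) * (Hev p (X k ω) * Hev p (X l ω))) P :=
    fun k l => ((AllLp.const _).mul ((h.allLp_hev _ k).mul (h.allLp_hev _ l))).integrable
  unfold GG
  rw [integral_const_mul, integral_finset_sum _ fun k _ => integrable_finset_sum _ fun l _ => I k l]
  simp only [integral_finset_sum _ fun l _ => I _ l, e, Nat.factorial_succ, ← Finset.mul_sum]
  push_cast
  ring

lemma GP.intGG_nonneg (h : GP X r P) (p n : ℕ) : 0 ≤ ∫ ω, GG p n r (fun l => X l ω) ∂P := by
  have := h.stein p n id (fun _ => 1) 1 (fun x => hasDerivAt_id x) continuous_const (by simp)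
  simp only [id, mul_one] at this
  rw [← this]
  exact integral_nonneg fun ω => mul_self_nonneg _

/-- Variance of the carré-du-champ. -/
lemma GP.varGG (h : GP X r P) (p : ℕ) : ∃ C : ℝ, 0 ≤ C ∧ ∀ n : ℕ,
    ∫ ω, (GG p n r (fun l => X l ω) - ∫ ω, GG p n r (fun l => X l ω) ∂P) ^ 2 ∂P ≤
    C * ((n : ℝ)⁻¹ * (n : ℝ)⁻¹ * ∑ i ∈ Finset.Icc (1 : ℤ) n, ∑ j ∈ Finset.Icc (1 : ℤ) n,
      ∑ k ∈ Finset.Icc (1 : ℤ) n, ∑ l ∈ Finset.Icc (1 : ℤ) n,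
      ((|r (j - i)| * |r (l - k)|) * (|r (k - i)| * |r (l - j)|) ^ p +
        (|r (j - i)| * |r (l - k)|) ^ p * (|r (k - i)| * |r (l - j)|) +
        (|r (j - i)| * |r (l - k)|) * (|r (l - i)| * |r (k - j)|) ^ p +
        (|r (j - i)| * |r (l - k)|) ^ p * (|r (l - i)| * |r (k - j)|))) := by
  obtain ⟨C, hC, HC⟩ := h.covbound p
  refine ⟨(p + 1 : ℝ) ^ 2 * C, by positivity, fun n => ?_⟩
  set I := Finset.Icc (1 : ℤ) n
  set B : ℤ → ℤ → ℤ → ℤ → ℝ := fun i j k l =>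
      ((|r (j - i)| * |r (l - k)|) * (|r (k - i)| * |r (l - j)|) ^ p +
        (|r (j - i)| * |r (l - k)|) ^ p * (|r (k - i)| * |r (l - j)|) +
        (|r (j - i)| * |r (l - k)|) * (|r (l - i)| * |r (k - j)|) ^ p +
        (|r (j - i)| * |r (l - k)|) ^ p * (|r (l - i)| * |r (k - j)|)) with hB
  set m : ℤ → ℤ → ℝ := fun i j => ∫ ω, Hev p (X i ω) * Hev p (X j ω) ∂P with hm
  set U : ℤ → ℤ → Ω → ℝ := fun i j ω => Hev p (X i ω) * Hev p (X j ω) - m i j with hU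
  have aH : ∀ i j, AllLp P (fun ω => Hev p (X i ω) * Hev p (X j ω)) := fun i j =>
    (h.allLp_hev p i).mul (h.allLp_hev p j)
  have aU : ∀ i j, AllLp P (U i j) := fun i j => (aH i j).sub (AllLp.const _)
  have e1 : ∀ ω, GG p n r (fun l => X l ω) - ∫ ω, GG p n r (fun l => X l ω) ∂P =
      ((p + 1 : ℝ) / n) * ∑ i ∈ I, ∑ j ∈ I, r (j - i) * U i j ω := by
    intro ω
    have : ∫ ω, GG p n r (fun l => X l ω) ∂P =
      ((p + 1 : ℝ) / n) * ∑ i ∈ I, ∑ j ∈ I, r (j - i) * m i j := by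
      have I' : ∀ k l, Integrable (fun ω => r (l - k) * (Hev p (X k ω) * Hev p (X l ω))) P :=
        fun k l => ((AllLp.const _).mul (aH k l)).integrable
      unfold GG
      rw [integral_const_mul,
        integral_finset_sum _ fun k _ => integrable_finset_sum _ fun l _ => I' k l]
      simp only [integral_finset_sum _ fun l _ => I' _ l, integral_const_mul, hm, I]
    rw [this]
    simp only [GG, hU, mul_sub, Finset.sum_sub_distrib, I]
  have e2 : ∀ i j k l, ∫ ω, U i j ω * U k l ω ∂P = M4 P X i j k l p p p p -
        M4 P X i j k l p p 0 0 * M4 P X i j k l 0 0 p p := by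
    intro i j k l
    have q1 : M4 P X i j k l p p 0 0 = m i j := by simp [M4, Hev_zero, hm]
    have q2 : M4 P X i j k l 0 0 p p = m k l := by simp [M4, Hev_zero, hm]
    have q3 : M4 P X i j k l p p p p =
      ∫ ω, (Hev p (X i ω) * Hev p (X j ω)) * (Hev p (X k ω) * Hev p (X l ω)) ∂P := by
      unfold M4; congr 1; ext ω; ring
    rw [q1, q2, q3]
    have q4 : ∀ ω, U i j ω * U k l ω =
        ((Hev p (X i ω) * Hev p (X j ω)) * (Hev p (X k ω) * Hev p (X l ω)) -
        m k l * (Hev p (X i ω) * Hev p (X j ω))) - (m i j * (Hev p (X k ω) * Hev p (X l ω)) -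
          m i j * m k l) := by
      intro ω; simp only [hU]; ring
    simp only [q4]
    rw [integral_sub, integral_sub, integral_sub, integral_const_mul, integral_const_mul]
    · simp [hm]; ring
    · exact (aH k l).integrable.const_mul _
    · exact integrable_const _
    · exact ((aH i j).mul (aH k l)).integrable
    · exact (aH i j).integrable.const_mul _
    · exact (((aH i j).mul (aH k l)).integrable).sub ((aH i j).integrable.const_mul _)
    · exact ((aH k l).integrable.const_mul _).sub (integrable_const _)
  have e3 : ∫ ω, (GG p n r (fun l => X l ω) - ∫ ω, GG p n r (fun l => X l ω) ∂P) ^ 2 ∂P =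
      ((p + 1 : ℝ) / n) ^ 2 * ∑ i ∈ I, ∑ j ∈ I, ∑ k ∈ I, ∑ l ∈ I,
        r (j - i) * r (l - k) * (M4 P X i j k l p p p p -
        M4 P X i j k l p p 0 0 * M4 P X i j k l 0 0 p p) := by
    have IU : ∀ i j k l, Integrable (fun ω => r (j - i) * r (l - k) * (U i j ω * U k l ω)) P :=
      fun i j k l => ((AllLp.const _).mul ((aU i j).mul (aU k l))).integrable
    have pw : ∀ ω, (GG p n r (fun l => X l ω) - ∫ ω, GG p n r (fun l => X l ω) ∂P) ^ 2 =
        ((p + 1 : ℝ) / n) ^ 2 * ∑ i ∈ I, ∑ j ∈ I, ∑ k ∈ I, ∑ l ∈ I,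
          r (j - i) * r (l - k) * (U i j ω * U k l ω) := by
      intro ω
      rw [e1, mul_pow]
      congr 1
      rw [pow_two, Finset.sum_mul]
      refine Finset.sum_congr rfl fun i _ => ?_
      rw [Finset.sum_mul]
      refine Finset.sum_congr rfl fun j _ => ?_
      rw [Finset.mul_sum]
      refine Finset.sum_congr rfl fun k _ => ?_
      rw [Finset.mul_sum]
      refine Finset.sum_congr rfl fun l _ => ?_
      ring
    simp only [pw]
    rw [integral_const_mul, integral_finset_sum _ fun i _ => integrable_finset_sum _ fun j _ =>
      integrable_finset_sum _ fun k _ => integrable_finset_sum _ fun l _ => IU i j k l]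
    congr 1
    refine Finset.sum_congr rfl fun i _ => ?_
    rw [integral_finset_sum _ fun j _ => 
      integrable_finset_sum _ fun k _ => integrable_finset_sum _ fun l _ => IU i j k l]
    refine Finset.sum_congr rfl fun j _ => ?_
    rw [integral_finset_sum _ fun k _ => integrable_finset_sum _ fun l _ => IU i j k l]
    refine Finset.sum_congr rfl fun k _ => ?_
    rw [integral_finset_sum _ fun l _ => IU i j k l]
    refine Finset.sum_congr rfl fun l _ => ?_
    rw [integral_const_mul, e2]
  rw [e3]
  have e4 : ∑ i ∈ I, ∑ j ∈ I, ∑ k ∈ I, ∑ l ∈ I,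
        r (j - i) * r (l - k) * (M4 P X i j k l p p p p -
        M4 P X i j k l p p 0 0 * M4 P X i j k l 0 0 p p) ≤
      C * ∑ i ∈ I, ∑ j ∈ I, ∑ k ∈ I, ∑ l ∈ I, B i j k l := by
    simp only [Finset.mul_sum]
    refine Finset.sum_le_sum fun i _ => Finset.sum_le_sum fun j _ => Finset.sum_le_sum fun k _ =>
      Finset.sum_le_sum fun l _ => ?_
    exact (le_abs_self _).trans (HC i j k l)
  calc _ ≤ ((p + 1 : ℝ) / n) ^ 2 * (C * ∑ i ∈ I, ∑ j ∈ I, ∑ k ∈ I, ∑ l ∈ I, B i j k l) := by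
        gcongr
    _ = _ := by
      rw [div_eq_mul_inv]; ring

end

lemma summable_pow_nat (β : ℝ) (h : β < -1) : Summable (fun t : ℕ => (1 + (t : ℝ)) ^ β) := by
  have := (summable_nat_add_iff 1).2 (Real.summable_nat_rpow.2 h)
  refine this.congr fun t => ?_
  push_cast; rw [add_comm]

lemma summable_pow_int (β : ℝ) (h : β < -1) :
    Summable (fun j : ℤ => (1 + (j.natAbs : ℝ)) ^ β) := by
  refine Summable.of_nat_of_neg ?_ ?_
  · simpa using summable_pow_nat β h
  · simpa using summable_pow_nat β h

lemma sumE (β e : ℝ) (h : (0 < e ∧ e ≤ 1 ∧ β ≤ e - 1) ∨ (β < -1 ∧ e = 0)) :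
    ∃ C : ℝ, 0 ≤ C ∧ ∀ n : ℕ, 1 ≤ n →
      ∑ t ∈ Finset.range (n + 1), (1 + (t : ℝ)) ^ β ≤ C * (n : ℝ) ^ e := by
  rcases h with ⟨h0, h1, h2⟩ | ⟨h0, rfl⟩
  · have key : ∀ n : ℕ, ∑ t ∈ Finset.range (n + 1), (1 + (t : ℝ)) ^ β ≤
        e⁻¹ * ((n : ℝ) + 1) ^ e := by
      intro n
      induction n with
      | zero => simp; exact (one_le_inv₀ h0).2 h1
      | succ n ih =>
        rw [Finset.sum_range_succ]
        push_cast
        set y : ℝ := (n : ℝ) + 1 + 1 with hy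
        have y0 : 0 < y := by positivity
        have hn : (n : ℝ) + 1 = y * (1 + -y⁻¹) := by field_simp; rw [hy]; ring
        have yi : y⁻¹ ≤ 1 := by
          apply inv_le_one_of_one_le₀; rw [hy]; linarith [n.cast_nonneg (α := ℝ)]
        have b1 : (1 + -y⁻¹) ^ e ≤ 1 + e * -y⁻¹ :=
          rpow_one_add_le_one_add_mul_self (by linarith) h0.le h1
        have b2 : (1 + ((n : ℝ) + 1)) ^ β ≤ y ^ e * y⁻¹ := by
          have : y ^ e * y⁻¹ = y ^ (e - 1) := by rw [Real.rpow_sub_one y0.ne']; rfl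
          rw [this, show 1 + ((n : ℝ) + 1) = y by rw [hy]; ring]
          exact Real.rpow_le_rpow_of_exponent_le (by rw [hy]; linarith [n.cast_nonneg (α := ℝ)]) h2
        rw [hn, Real.mul_rpow y0.le (by linarith)] at ih
        have b3 : e⁻¹ * (y ^ e * (1 + -y⁻¹) ^ e) ≤ e⁻¹ * (y ^ e * (1 + e * -y⁻¹)) := by
          gcongr
        have b4 : e⁻¹ * (y ^ e * (1 + e * -y⁻¹)) = e⁻¹ * y ^ e - y ^ e * y⁻¹ := by
          field_simp; ring
        linarith
    refine ⟨e⁻¹ * 2 ^ e, by positivity, fun n hn => (key n).trans ?_⟩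
    rw [mul_assoc, ← Real.mul_rpow (by norm_num) (by positivity)]
    gcongr
    have : (1 : ℝ) ≤ n := by exact_mod_cast hn
    linarith
  · refine ⟨∑' t : ℕ, (1 + (t : ℝ)) ^ β, tsum_nonneg fun t => by positivity, fun n _ => ?_⟩
    rw [Real.rpow_zero, mul_one]
    exact (summable_pow_nat β h0).sum_le_tsum _ fun t _ => by positivity

lemma row_nat (n : ℕ) (f : ℕ → ℝ) (hf : ∀ t, 0 ≤ f t) (i : ℤ) (hi : i ∈ Finset.Icc (1 : ℤ) n) :
    ∑ j ∈ Finset.Icc (1 : ℤ) n, f (j - i).natAbs ≤ 2 * ∑ t ∈ Finset.range (n + 1), f t := by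
  rw [← Finset.sum_fiberwise_of_maps_to (s := Finset.Icc (1 : ℤ) n) (t := Finset.range (n + 1))
    (g := fun j => (j - i).natAbs), Finset.mul_sum]
  · refine Finset.sum_le_sum fun t _ => ?_
    rw [Finset.sum_congr rfl (g := fun _ => f t)]
    · rw [Finset.sum_const, nsmul_eq_mul]
      refine mul_le_mul_of_nonneg_right ?_ (hf t)
      have : (Finset.filter (fun j : ℤ => (j - i).natAbs = t) (Finset.Icc (1 : ℤ) n)) ⊆
          {i + t, i - t} := by
        intro j hj
        simp only [Finset.mem_filter, Finset.mem_insert, Finset.mem_singleton] at hj ⊢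
        omega
      exact_mod_cast (Finset.card_le_card this).trans Finset.card_le_two
    · intro j hj
      simp only [Finset.mem_filter] at hj
      rw [hj.2]
  · intro j hj
    simp only [Finset.mem_Icc, Finset.mem_range] at *
    omega

lemma row_bound (r : ℤ → ℝ) (K b : ℝ) (hr : ∀ j, |r j| ≤ K * (1 + (j.natAbs : ℝ)) ^ b)
    (k : ℕ) (e : ℝ) (h : (0 < e ∧ e ≤ 1 ∧ b * k ≤ e - 1) ∨ (b * k < -1 ∧ e = 0)) :
    ∃ C : ℝ, 0 ≤ C ∧ ∀ n : ℕ, 1 ≤ n → ∀ i ∈ Finset.Icc (1 : ℤ) n,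
      ∑ j ∈ Finset.Icc (1 : ℤ) n, |r (j - i)| ^ k ≤ C * (n : ℝ) ^ e := by
  obtain ⟨C, hC, HC⟩ := sumE (b * k) e h
  have hK : 0 ≤ K := by have := (abs_nonneg _).trans (hr 0); simpa using this
  refine ⟨K ^ k * (2 * C), by positivity, fun n hn i hi => ?_⟩
  have h1 : ∀ j : ℤ, |r j| ^ k ≤ K ^ k * (1 + (j.natAbs : ℝ)) ^ (b * k) := by
    intro j
    rw [Real.rpow_mul (by positivity), Real.rpow_natCast, ← mul_pow]
    exact pow_le_pow_left₀ (abs_nonneg _) (hr j) k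
  calc _ ≤ ∑ j ∈ Finset.Icc (1 : ℤ) n, K ^ k * (1 + ((j - i).natAbs : ℝ)) ^ (b * k) :=
        Finset.sum_le_sum fun j _ => h1 _
    _ ≤ K ^ k * (2 * ∑ t ∈ Finset.range (n + 1), (1 + (t : ℝ)) ^ (b * k)) := by
        rw [← Finset.mul_sum]
        gcongr
        exact row_nat n (fun t => (1 + (t : ℝ)) ^ (b * k)) (fun t => by positivity) i hi
    _ ≤ K ^ k * (2 * (C * (n : ℝ) ^ e)) := by gcongr; exact HC n hn
    _ = _ := by ring

lemma path_bound (I : Finset ℤ) (u v : ℤ → ℤ → ℝ) (A B : ℝ)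
    (hu : ∀ i j, 0 ≤ u i j) (hv : ∀ i j, 0 ≤ v i j) (hB0 : 0 ≤ B)
    (hA : ∀ i ∈ I, ∑ j ∈ I, u i j ≤ A) (hB : ∀ i ∈ I, ∑ j ∈ I, v i j ≤ B) :
    ∑ i ∈ I, ∑ j ∈ I, ∑ k ∈ I, ∑ l ∈ I, u i j * (v i k * v j l) ≤ (I.card : ℝ) * (A * B * B) := by
  have h1 : ∀ i ∈ I, ∑ j ∈ I, ∑ k ∈ I, ∑ l ∈ I, u i j * (v i k * v j l) ≤ A * B * B := by
    intro i hi
    have h2 : ∀ j ∈ I, ∑ k ∈ I, ∑ l ∈ I, u i j * (v i k * v j l) ≤ u i j * (B * B) := by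
      intro j hj
      simp only [← Finset.mul_sum]
      rw [← Finset.sum_mul]
      refine mul_le_mul_of_nonneg_left ?_ (hu i j)
      exact mul_le_mul (hB i hi) (hB j hj) (Finset.sum_nonneg fun _ _ => hv _ _) hB0
    refine (Finset.sum_le_sum h2).trans ?_
    rw [← Finset.sum_mul, mul_assoc]
    exact mul_le_mul_of_nonneg_right (hA i hi) (mul_nonneg hB0 hB0)
  refine (Finset.sum_le_sum h1).trans ?_
  rw [Finset.sum_const, nsmul_eq_mul]

lemma four_one (I : Finset ℤ) (d : ℤ → ℤ → ℝ) (p : ℕ) (A B : ℝ)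
    (hd : ∀ i j, 0 ≤ d i j) (hs : ∀ i j, d i j = d j i) (hB0 : 0 ≤ B)
    (hA : ∀ i ∈ I, ∑ j ∈ I, d i j ^ 2 ≤ A) (hB : ∀ i ∈ I, ∑ j ∈ I, d i j ^ p ≤ B) :
    ∑ i ∈ I, ∑ j ∈ I, ∑ k ∈ I, ∑ l ∈ I, (d i j * d k l) * (d i k * d j l) ^ p ≤
      (I.card : ℝ) * (A * B * B) := by
  have P1 := path_bound I (fun i j => d i j ^ 2) (fun i j => d i j ^ p) A B
    (fun i j => by positivity) (fun i j => pow_nonneg (hd i j) p) hB0 hA hB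
  have P2 : ∑ i ∈ I, ∑ j ∈ I, ∑ k ∈ I, ∑ l ∈ I, d k l ^ 2 * (d i k ^ p * d j l ^ p) ≤
      (I.card : ℝ) * (A * B * B) := by
    refine le_trans (le_of_eq ?_) P1
    have s1 : ∀ i, ∑ j ∈ I, ∑ k ∈ I, ∑ l ∈ I, d k l ^ 2 * (d i k ^ p * d j l ^ p) =
        ∑ k ∈ I, ∑ l ∈ I, ∑ j ∈ I, d k l ^ 2 * (d i k ^ p * d j l ^ p) := by
      intro i
      rw [Finset.sum_comm]
      exact Finset.sum_congr rfl fun k _ => Finset.sum_comm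
    simp only [s1]
    rw [Finset.sum_comm]
    refine Finset.sum_congr rfl fun k _ => ?_
    rw [Finset.sum_comm]
    refine Finset.sum_congr rfl fun l _ => Finset.sum_congr rfl fun i _ =>
      Finset.sum_congr rfl fun j _ => ?_
    rw [hs i k, hs j l]
  have P3 : ∑ i ∈ I, ∑ j ∈ I, ∑ k ∈ I, ∑ l ∈ I, (d i j * d k l) * (d i k * d j l) ^ p ≤
      ∑ i ∈ I, ∑ j ∈ I, ∑ k ∈ I, ∑ l ∈ I, (1 / 2 * (d i j ^ 2 * (d i k ^ p * d j l ^ p)) +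
        1 / 2 * (d k l ^ 2 * (d i k ^ p * d j l ^ p))) := by
    refine Finset.sum_le_sum fun i _ => Finset.sum_le_sum fun j _ => Finset.sum_le_sum fun k _ =>
      Finset.sum_le_sum fun l _ => ?_
    have w : 0 ≤ d i k ^ p * d j l ^ p := mul_nonneg (pow_nonneg (hd _ _) _) (pow_nonneg (hd _ _) _)
    rw [mul_pow]
    nlinarith [mul_nonneg w (sq_nonneg (d i j - d k l))]
  simp only [Finset.sum_add_distrib, ← Finset.mul_sum] at P1 P2 P3
  linarith

lemma four_all (I : Finset ℤ) (d : ℤ → ℤ → ℝ) (p : ℕ) (A B : ℝ)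
    (hd : ∀ i j, 0 ≤ d i j) (hs : ∀ i j, d i j = d j i) (hB0 : 0 ≤ B)
    (hA : ∀ i ∈ I, ∑ j ∈ I, d i j ^ 2 ≤ A) (hB : ∀ i ∈ I, ∑ j ∈ I, d i j ^ p ≤ B) :
    ∑ i ∈ I, ∑ j ∈ I, ∑ k ∈ I, ∑ l ∈ I, ((d i j * d k l) * (d i k * d j l) ^ p +
      (d i j * d k l) ^ p * (d i k * d j l) + (d i j * d k l) * (d i l * d j k) ^ p +
      (d i j * d k l) ^ p * (d i l * d j k)) ≤ 4 * ((I.card : ℝ) * (A * B * B)) := by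
  have P1 := four_one I d p A B hd hs hB0 hA hB
  have P2 : ∑ i ∈ I, ∑ j ∈ I, ∑ k ∈ I, ∑ l ∈ I, (d i j * d k l) ^ p * (d i k * d j l) ≤
      (I.card : ℝ) * (A * B * B) := by
    refine le_trans (le_of_eq ?_) P1
    refine Finset.sum_congr rfl fun i _ => ?_
    rw [Finset.sum_comm]
    refine Finset.sum_congr rfl fun j _ => Finset.sum_congr rfl fun k _ =>
      Finset.sum_congr rfl fun l _ => ?_
    ring
  have sw : ∀ f : ℤ → ℤ → ℤ → ℤ → ℝ, ∑ i ∈ I, ∑ j ∈ I, ∑ k ∈ I, ∑ l ∈ I, f i j k l =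
      ∑ i ∈ I, ∑ j ∈ I, ∑ k ∈ I, ∑ l ∈ I, f i j l k := fun f =>
    Finset.sum_congr rfl fun i _ => Finset.sum_congr rfl fun j _ => Finset.sum_comm
  have P3 : ∑ i ∈ I, ∑ j ∈ I, ∑ k ∈ I, ∑ l ∈ I, (d i j * d k l) * (d i l * d j k) ^ p ≤
      (I.card : ℝ) * (A * B * B) := by
    rw [sw]
    refine le_trans (le_of_eq ?_) P1
    refine Finset.sum_congr rfl fun i _ => Finset.sum_congr rfl fun j _ =>
      Finset.sum_congr rfl fun k _ => Finset.sum_congr rfl fun l _ => ?_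
    rw [hs l k]
  have P4 : ∑ i ∈ I, ∑ j ∈ I, ∑ k ∈ I, ∑ l ∈ I, (d i j * d k l) ^ p * (d i l * d j k) ≤
      (I.card : ℝ) * (A * B * B) := by
    rw [sw]
    refine le_trans (le_of_eq ?_) P2
    refine Finset.sum_congr rfl fun i _ => Finset.sum_congr rfl fun j _ =>
      Finset.sum_congr rfl fun k _ => Finset.sum_congr rfl fun l _ => ?_
    rw [hs l k]
  simp only [Finset.sum_add_distrib]
  linarith

lemma count_bound (n : ℕ) (j : ℤ) (θ : ℝ) (h0 : 0 ≤ θ) (h1 : θ ≤ 1) (hn : 1 ≤ n) :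
    (((Finset.Icc (1 : ℤ) n).filter (fun k => k + j ∉ Finset.Icc (1 : ℤ) n)).card : ℝ) ≤
      (n : ℝ) ^ (1 - θ) * (1 + (j.natAbs : ℝ)) ^ θ := by
  set c := ((Finset.Icc (1 : ℤ) n).filter (fun k => k + j ∉ Finset.Icc (1 : ℤ) n)).card
  have c1 : c ≤ n := by
    refine (Finset.card_filter_le _ _).trans ?_
    simp
  have c2 : c ≤ j.natAbs := by
    rcases le_total 0 j with hj | hj
    · refine (Finset.card_le_card (t := Finset.Icc ((n : ℤ) + 1 - j) n) ?_).trans ?_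
      · intro k hk
        simp only [Finset.mem_filter, Finset.mem_Icc] at hk ⊢
        omega
      · simp only [Int.card_Icc]; omega
    · refine (Finset.card_le_card (t := Finset.Icc 1 (-j)) ?_).trans ?_
      · intro k hk
        simp only [Finset.mem_filter, Finset.mem_Icc] at hk ⊢
        omega
      · simp only [Int.card_Icc]; omega
  have c1' : (c : ℝ) ≤ n := by exact_mod_cast c1
  have c2' : (c : ℝ) ≤ 1 + (j.natAbs : ℝ) := by
    have : (c : ℝ) ≤ (j.natAbs : ℝ) := by exact_mod_cast c2
    linarith
  rcases Nat.eq_zero_or_pos c with h | h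
  · rw [h]; simp only [Nat.cast_zero]; positivity
  · have hc : (0 : ℝ) < c := by exact_mod_cast h
    calc (c : ℝ) = (c : ℝ) ^ (1 - θ) * (c : ℝ) ^ θ := by
          rw [← Real.rpow_add hc]; simp
      _ ≤ _ := by
          gcongr

lemma mean_bound (r : ℤ → ℝ) (K b : ℝ) (hr : ∀ j, |r j| ≤ K * (1 + (j.natAbs : ℝ)) ^ b)
    (q : ℕ) (θ : ℝ) (h0 : 0 ≤ θ) (h1 : θ ≤ 1) (hb : b * q + θ < -1) :
    ∃ C : ℝ, 0 ≤ C ∧ ∀ n : ℕ, 1 ≤ n →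
      |(n : ℝ)⁻¹ * ∑ k ∈ Finset.Icc (1 : ℤ) n, ∑ l ∈ Finset.Icc (1 : ℤ) n, r (l - k) ^ q -
        ∑' j, r j ^ q| ≤ C * (n : ℝ) ^ (-θ) := by
  have hK : 0 ≤ K := by have := (abs_nonneg _).trans (hr 0); simpa using this
  have hp : ∀ j : ℤ, |r j ^ q| ≤ K ^ q * (1 + (j.natAbs : ℝ)) ^ (b * q) := by
    intro j
    rw [abs_pow, Real.rpow_mul (by positivity), Real.rpow_natCast, ← mul_pow]
    exact pow_le_pow_left₀ (abs_nonneg _) (hr j) q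
  have hsum : Summable (fun j => r j ^ q) :=
    Summable.of_norm_bounded ((summable_pow_int (b * q) (by linarith)).mul_left (K ^ q)) hp
  have hS := hsum.hasSum
  set S := ∑' j, r j ^ q
  have hW := ((summable_pow_int (b * q + θ) hb).mul_left (K ^ q)).hasSum
  set W := ∑' j : ℤ, K ^ q * (1 + (j.natAbs : ℝ)) ^ (b * q + θ) with hWd
  refine ⟨W, tsum_nonneg fun j => by positivity, fun n hn => ?_⟩
  have n0 : (0 : ℝ) < n := by exact_mod_cast hn
  set I := Finset.Icc (1 : ℤ) n
  have cI : (I.card : ℝ) = n := by simp [I]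
  have k1 : ∀ k ∈ I, HasSum (fun j => if k + j ∉ I then r j ^ q else 0)
      (S - ∑ l ∈ I, r (l - k) ^ q) := by
    intro k _
    have a1 : HasSum (fun l : ℤ => if l ∈ I then r (l - k) ^ q else 0)
        (∑ l ∈ I, r (l - k) ^ q) := by
      have := hasSum_sum_of_ne_finset_zero (f := fun l : ℤ => if l ∈ I then r (l - k) ^ q else 0)
        (s := I) (fun l hl => by simp [hl]) (L := .unconditional ℤ)
      rwa [Finset.sum_congr rfl (g := fun l => r (l - k) ^ q) (fun l hl => by simp [hl])] at this
    have a2 := ((Equiv.addLeft k).hasSum_iff).2 a1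
    refine (hS.sub a2).congr_fun ?_
    intro j
    simp only [Function.comp, Equiv.coe_addLeft, add_sub_cancel_left]
    split_ifs <;> simp_all
  have k2 := hasSum_sum k1
  have k3 := k2.norm_le_of_bounded (hW.mul_left ((n : ℝ) ^ (1 - θ))) (by
    intro j
    rw [← Finset.sum_filter, Finset.sum_const, nsmul_eq_mul, norm_mul, Real.norm_eq_abs,
      Real.norm_eq_abs, Nat.abs_cast]
    calc _ ≤ ((n : ℝ) ^ (1 - θ) * (1 + (j.natAbs : ℝ)) ^ θ) *
        (K ^ q * (1 + (j.natAbs : ℝ)) ^ (b * q)) :=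
          mul_le_mul (count_bound n j θ h0 h1 hn) (hp j) (abs_nonneg _) (by positivity)
      _ = _ := by rw [Real.rpow_add (by positivity)]; ring)
  rw [Finset.sum_sub_distrib, Finset.sum_const, nsmul_eq_mul, cI, Real.norm_eq_abs] at k3
  set T := ∑ k ∈ I, ∑ l ∈ I, r (l - k) ^ q
  have e1 : (n : ℝ)⁻¹ * T - S = -((n : ℝ)⁻¹ * (n * S - T)) := by field_simp; ring
  rw [e1, abs_neg, abs_mul, abs_of_pos (by positivity)]
  calc _ ≤ (n : ℝ)⁻¹ * ((n : ℝ) ^ (1 - θ) * W) := by gcongr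
    _ = _ := by
      rw [sub_eq_add_neg, Real.rpow_add n0, Real.rpow_one]; field_simp

lemma rH_neg (H : ℝ) (j : ℤ) : rH H (-j) = rH H j := by
  unfold rH
  push_cast
  rw [show -(j : ℝ) + 1 = -((j : ℝ) - 1) by ring, show -(j : ℝ) - 1 = -((j : ℝ) + 1) by ring]
  simp only [abs_neg]; ring

lemma rH_decay_aux (H : ℝ) (hH0 : 0 < H) (hH1 : H < 1) (x : ℝ) (hx : 1 < x) :
    |(x + 1) ^ (2 * H) - 2 * x ^ (2 * H) + (x - 1) ^ (2 * H)| ≤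
      (2 * H * |2 * H - 1|) * (x - 1) ^ (2 * H - 2) := by
  have d1 : ∀ y : ℝ, 0 < y → HasDerivAt (fun y : ℝ => y ^ (2 * H)) (2 * H * y ^ (2 * H - 1)) y :=
    fun y hy => Real.hasDerivAt_rpow_const (Or.inl hy.ne')
  have d1' : ∀ y : ℝ, 0 < y → HasDerivAt (fun y : ℝ => (y + 1) ^ (2 * H))
      (2 * H * (y + 1) ^ (2 * H - 1)) y := by
    intro y hy
    have := (d1 (y + 1) (by linarith)).comp_add_const y 1
    exact this
  have d2 : ∀ y : ℝ, 0 < y → HasDerivAt (fun y : ℝ => 2 * H * y ^ (2 * H - 1))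
      (2 * H * ((2 * H - 1) * y ^ (2 * H - 1 - 1))) y :=
    fun y hy => (Real.hasDerivAt_rpow_const (Or.inl hy.ne')).const_mul _
  have D : ∀ y : ℝ, 0 < y → HasDerivAt (fun y : ℝ => (y + 1) ^ (2 * H) - y ^ (2 * H))
      (2 * H * (y + 1) ^ (2 * H - 1) - 2 * H * y ^ (2 * H - 1)) y :=
    fun y hy => (d1' y hy).sub (d1 y hy)
  obtain ⟨ξ, hξ, e1⟩ := exists_hasDerivAt_eq_slope (fun y : ℝ => (y + 1) ^ (2 * H) - y ^ (2 * H))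
    (fun y => 2 * H * (y + 1) ^ (2 * H - 1) - 2 * H * y ^ (2 * H - 1)) (a := x - 1) (b := x)
    (by linarith)
    (fun y hy => (D y (by linarith [hy.1])).continuousAt.continuousWithinAt)
    (fun y hy => D y (by linarith [hy.1]))
  obtain ⟨η, hη, e2⟩ := exists_hasDerivAt_eq_slope (fun y : ℝ => 2 * H * y ^ (2 * H - 1))
    (fun y => 2 * H * ((2 * H - 1) * y ^ (2 * H - 1 - 1))) (a := ξ) (b := ξ + 1)
    (by linarith)
    (fun y hy => (d2 y (by linarith [hy.1, hξ.1])).continuousAt.continuousWithinAt)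
    (fun y hy => d2 y (by linarith [hy.1, hξ.1]))
  have η0 : x - 1 ≤ η := by linarith [hη.1, hξ.1]
  simp only [add_sub_cancel_left, sub_sub_cancel, div_one, sub_add_cancel] at e1 e2
  have e3 : (x + 1) ^ (2 * H) - 2 * x ^ (2 * H) + (x - 1) ^ (2 * H) =
      2 * H * ((2 * H - 1) * η ^ (2 * H - 1 - 1)) := by
    rw [e2, e1]; ring
  rw [e3, abs_mul, abs_of_pos (by linarith : 0 < 2 * H), abs_mul,
    abs_of_nonneg (Real.rpow_nonneg (by linarith) _), show 2 * H - 1 - 1 = 2 * H - 2 by ring,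
    mul_assoc (2 * H) |2 * H - 1|]
  refine mul_le_mul_of_nonneg_left (mul_le_mul_of_nonneg_left ?_ (abs_nonneg _)) (by linarith)
  exact Real.rpow_le_rpow_of_nonpos (by linarith) η0 (by linarith)

lemma rH_decay (H : ℝ) (hH0 : 0 < H) (hH1 : H < 1) : ∃ K b : ℝ,
    (∀ j, |rH H j| ≤ K * (1 + (j.natAbs : ℝ)) ^ b) ∧ (-1 < 2 * H - 2 → b = 2 * H - 2) ∧
      (2 * H - 2 ≤ -1 → b < -1) := by
  obtain ⟨b, hb1, hb2, hb3, hb0⟩ : ∃ b : ℝ, (-1 < 2 * H - 2 → b = 2 * H - 2) ∧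
      (2 * H - 2 ≤ -1 → b < -1) ∧ (2 * H - 1 ≠ 0 → b = 2 * H - 2) ∧ b < 0 := by
    by_cases h : 2 * H - 1 = 0
    · exact ⟨-2, fun _ => by linarith, fun _ => by norm_num, fun h' => absurd h h', by norm_num⟩
    · refine ⟨2 * H - 2, fun _ => rfl, fun h' => lt_of_le_of_ne h' ?_, fun _ => rfl, by linarith⟩
      intro h''; apply h; linarith
  set K := |rH H 0| + |rH H 1| * 2 ^ (-b) + (2 * H * |2 * H - 1|) * 3 ^ (-b) with hK
  refine ⟨K, b, ?_, hb1, hb2⟩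
  have main : ∀ t : ℕ, |rH H t| ≤ K * (1 + (t : ℝ)) ^ b := by
    intro t
    have p1 : 0 ≤ |rH H 1| * 2 ^ (-b) := by positivity
    have p2 : 0 ≤ (2 * H * |2 * H - 1|) * 3 ^ (-b) := by positivity
    have p0 := abs_nonneg (rH H 0)
    rcases Nat.lt_or_ge t 2 with h | h
    · interval_cases t
      · simp; linarith
      · have : |rH H 1| = |rH H 1| * 2 ^ (-b) * 2 ^ b := by
          rw [mul_assoc, ← Real.rpow_add (by norm_num)]; simp
        norm_num
        calc |rH H 1| = |rH H 1| * 2 ^ (-b) * 2 ^ b := this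
          _ ≤ K * 2 ^ b := by gcongr; linarith
    · have ht : (2 : ℝ) ≤ t := by exact_mod_cast h
      have A := rH_decay_aux H hH0 hH1 t (by linarith)
      have E : |rH H t| = 1 / 2 * |((t : ℝ) + 1) ^ (2 * H) - 2 * (t : ℝ) ^ (2 * H) +
          ((t : ℝ) - 1) ^ (2 * H)| := by
        unfold rH
        push_cast
        rw [abs_of_nonneg (by linarith : (0 : ℝ) ≤ (t : ℝ) + 1),
          abs_of_nonneg (by linarith : (0 : ℝ) ≤ (t : ℝ)),
          abs_of_nonneg (by linarith : (0 : ℝ) ≤ (t : ℝ) - 1), abs_mul,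
          abs_of_pos (by norm_num : (0 : ℝ) < 1 / 2)]
      have E2 : (2 * H * |2 * H - 1|) * ((t : ℝ) - 1) ^ (2 * H - 2) ≤
          (2 * H * |2 * H - 1|) * 3 ^ (-b) * (1 + (t : ℝ)) ^ b := by
        by_cases h1 : 2 * H - 1 = 0
        · simp only [h1, abs_zero, mul_zero, zero_mul, le_refl]
        · rw [← hb3 h1, mul_assoc (2 * H * |2 * H - 1|)]
          refine mul_le_mul_of_nonneg_left ?_ (by positivity)
          have : ((1 + (t : ℝ)) / 3) ^ b = 3 ^ (-b) * (1 + (t : ℝ)) ^ b := by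
            rw [Real.div_rpow (by positivity) (by norm_num), Real.rpow_neg (by norm_num)]
            field_simp
          rw [← this]
          exact Real.rpow_le_rpow_of_nonpos (by positivity) (by linarith) hb0.le
      have E3 : (2 * H * |2 * H - 1|) * 3 ^ (-b) * (1 + (t : ℝ)) ^ b ≤ K * (1 + (t : ℝ)) ^ b := by
        gcongr; linarith
      rw [E]
      have := abs_nonneg (((t : ℝ) + 1) ^ (2 * H) - 2 * (t : ℝ) ^ (2 * H) +
          ((t : ℝ) - 1) ^ (2 * H))
      linarith
  intro j
  obtain ⟨t, rfl | rfl⟩ := j.eq_nat_or_neg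
  · simpa using main t
  · rw [rH_neg]; simpa using main t

lemma rH_zero (H : ℝ) (hH0 : 0 < H) : rH H 0 = 1 := by
  unfold rH
  simp [Real.zero_rpow (by linarith : 2 * H ≠ 0)]
  norm_num

/-- Existence of the growth exponents. -/
lemma exps (H b : ℝ) (hH0 : 0 < H) (hH1 : H < 1) (q : ℕ) (hq : 2 ≤ q)
    (hHq : H < 1 - 1 / (2 * (q : ℝ))) (hb1 : -1 < 2 * H - 2 → b = 2 * H - 2)
    (hb2 : 2 * H - 2 ≤ -1 → b < -1) (φ : ℝ)
    (hφ : φ = if 2 * H - 2 ≤ -1 then -(1 : ℝ) / 2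
           else if 2 * H - 2 ≤ -(1 : ℝ) / ((q : ℝ) - 1) then (2 * H - 2) / 2
           else ((2 * H - 2) * q + 1) / 2) :
    (φ < 0 ∧ -1 ≤ φ ∧ b * q + -φ < -1) ∧ ∃ e f : ℝ, 
      ((0 < e ∧ e ≤ 1 ∧ b * (2 : ℕ) ≤ e - 1) ∨ (b * (2 : ℕ) < -1 ∧ e = 0)) ∧
      ((0 < f ∧ f ≤ 1 ∧ b * (q - 1 : ℕ) ≤ f - 1) ∨ (b * (q - 1 : ℕ) < -1 ∧ f = 0)) ∧
      -1 + e + 2 * f ≤ 2 * φ := by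
  have hq' : (2 : ℝ) ≤ q := by exact_mod_cast hq
  have hQ : ((q - 1 : ℕ) : ℝ) = (q : ℝ) - 1 := by push_cast [Nat.cast_sub (by omega : 1 ≤ q)]; ring
  have haq : (2 * H - 2) * q < -1 := by
    have : 1 / (2 * (q : ℝ)) < 1 - H := by linarith
    rw [div_lt_iff₀ (by positivity)] at this
    nlinarith
  rw [hQ]
  push_cast
  rcases le_or_gt (2 * H - 2) (-1) with ha | ha
  · rw [if_pos ha] at hφ
    have hb := hb2 ha
    refine ⟨⟨by linarith, by linarith, by nlinarith⟩, 0, ?_⟩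
    rcases eq_or_lt_of_le hq with h2 | h2
    · exact ⟨0, Or.inr ⟨by linarith, rfl⟩, Or.inr ⟨by rw [← h2]; norm_num; exact hb, rfl⟩, by linarith⟩
    · exact ⟨0, Or.inr ⟨by linarith, rfl⟩, Or.inr ⟨by nlinarith, rfl⟩, by linarith⟩
  · rw [if_neg (not_le.2 ha)] at hφ
    have hb := hb1 ha
    rw [hb]
    clear hb hb1 hb2
    set a := 2 * H - 2 with hadef
    have a0 : a < 0 := by rw [hadef]; linarith
    clear_value a
    have q1 : 0 < (q : ℝ) - 1 := by linarith
    -- the two-case rate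
    have cond : a ≤ -(1 : ℝ) / ((q : ℝ) - 1) ↔ a * (q - 1) ≤ -1 := by
      rw [le_div_iff₀ q1]
    simp only [cond] at hφ
    -- exponent for the square sums
    have sq : ∀ δ : ℝ, 0 < δ → ∃ e : ℝ, ((0 < e ∧ e ≤ 1 ∧ a * 2 ≤ e - 1) ∨ (a * 2 < -1 ∧ e = 0)) ∧
        (e = 0 ∧ a * 2 < -1 ∨ e = 2 * a + 1 ∧ -1 < a * 2 ∨ a * 2 = -1 ∧ e ≤ δ) := by
      intro δ hδ
      rcases lt_trichotomy (a * 2) (-1) with h | h | h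
      · exact ⟨0, Or.inr ⟨h, rfl⟩, Or.inl ⟨rfl, h⟩⟩
      · exact ⟨min δ 1, Or.inl ⟨by positivity, min_le_right _ _, by linarith [lt_min hδ one_pos]⟩, Or.inr (Or.inr ⟨h, min_le_left _ _⟩)⟩
      · exact ⟨2 * a + 1, Or.inl ⟨by linarith, by linarith, by linarith⟩,
          Or.inr (Or.inl ⟨by ring, h⟩)⟩
    have sp : ∀ δ : ℝ, 0 < δ → ∃ f : ℝ, ((0 < f ∧ f ≤ 1 ∧ a * (q - 1) ≤ f - 1) ∨
        (a * (q - 1) < -1 ∧ f = 0)) ∧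
        (f = 0 ∧ a * (q - 1) < -1 ∨ f = a * (q - 1) + 1 ∧ -1 < a * (q - 1) ∨
          a * (q - 1) = -1 ∧ f ≤ δ) := by
      intro δ hδ
      rcases lt_trichotomy (a * (q - 1)) (-1) with h | h | h
      · exact ⟨0, Or.inr ⟨h, rfl⟩, Or.inl ⟨rfl, h⟩⟩
      · exact ⟨min δ 1, Or.inl ⟨by positivity, min_le_right _ _, by linarith [lt_min hδ one_pos]⟩, Or.inr (Or.inr ⟨h, min_le_left _ _⟩)⟩
      · exact ⟨a * (q - 1) + 1, Or.inl ⟨by linarith, by nlinarith, by linarith⟩,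
          Or.inr (Or.inl ⟨rfl, h⟩)⟩
    -- slack
    obtain ⟨δ, hδ, d1, d2, d3⟩ : ∃ δ : ℝ, 0 < δ ∧ 4 * δ ≤ 1 + a ∧ 4 * δ ≤ -a ∧ 
        4 * δ ≤ -(a * q + 1) := by
      refine ⟨min (1 + a) (min (-a) (-(a * q + 1))) / 4, ?_, ?_, ?_, ?_⟩
      · have : 0 < min (1 + a) (min (-a) (-(a * q + 1))) :=
          lt_min (by linarith) (lt_min (by linarith) (by linarith))
        linarith
      · linarith [min_le_left (1 + a) (min (-a) (-(a * q + 1)))]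
      · linarith [min_le_right (1 + a) (min (-a) (-(a * q + 1))), 
          min_le_left (-a) (-(a * q + 1))]
      · linarith [min_le_right (1 + a) (min (-a) (-(a * q + 1))), 
          min_le_right (-a) (-(a * q + 1))]
    obtain ⟨e, he, he'⟩ := sq δ hδ
    obtain ⟨f, hf, hf'⟩ := sp δ hδ
    rcases le_or_gt (a * (q - 1)) (-1) with hc | hc
    · rw [if_pos hc] at hφ
      refine ⟨⟨by linarith, by linarith, by linarith⟩, e, f, he, hf, ?_⟩
      rcases he' with ⟨h, h'⟩ | ⟨h, h'⟩ | ⟨h, h'⟩ <;> rcases hf' with ⟨g, g'⟩ | ⟨g, g'⟩ | ⟨g, g'⟩ <;>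
        linarith
    · rw [if_neg (not_le.2 hc)] at hφ
      refine ⟨⟨by linarith, by nlinarith, by linarith⟩, e, f, he, hf, ?_⟩
      rcases hf' with ⟨g, g'⟩ | ⟨g, g'⟩ | ⟨g, g'⟩
      · linarith
      · rcases eq_or_lt_of_le hq with h2 | h2
        · have hqr : (q : ℝ) = 2 := by rw [← h2]; norm_num
          rw [hqr] at g g' hφ haq
          rcases he' with ⟨h, h'⟩ | ⟨h, h'⟩ | ⟨h, h'⟩ <;> linarith
        · have q3 : (3 : ℝ) ≤ q := by exact_mod_cast h2
          rcases he' with ⟨h, h'⟩ | ⟨h, h'⟩ | ⟨h, h'⟩ <;> nlinarith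
      · linarith

lemma GP.final {Ω : Type} [MeasurableSpace Ω] {P : Measure Ω} [IsProbabilityMeasure P]
    {X : ℤ → Ω → ℝ} {r : ℤ → ℝ} (g : GP X r P) (p : ℕ) (K b φ e f : ℝ)
    (hr : ∀ j, |r j| ≤ K * (1 + (j.natAbs : ℝ)) ^ b)
    (hφ : φ < 0) (hφ1 : -1 ≤ φ) (hm : b * (p + 1 : ℕ) + -φ < -1)
    (he : (0 < e ∧ e ≤ 1 ∧ b * (2 : ℕ) ≤ e - 1) ∨ (b * (2 : ℕ) < -1 ∧ e = 0))
    (hf : (0 < f ∧ f ≤ 1 ∧ b * p ≤ f - 1) ∨ (b * p < -1 ∧ f = 0))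
    (hef : -1 + e + 2 * f ≤ 2 * φ) :
    ∃ C : ℝ, 0 < C ∧ ∀ n : ℕ, 1 ≤ n →
      ∫ ω, |GG p n r (fun l => X l ω) -
        (((p + 1).factorial : ℝ) * ∑' j, r j ^ (p + 1)).toNNReal| ∂P ≤ C * (n : ℝ) ^ φ := by
  obtain ⟨A, hA0, hA⟩ := row_bound r K b hr 2 e he
  obtain ⟨B, hB0, hB⟩ := row_bound r K b hr p f hf
  obtain ⟨M, hM0, hM⟩ := mean_bound r K b hr (p + 1) (-φ) (by linarith) (by linarith) hm
  obtain ⟨V, hV0, hV⟩ := g.varGG p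
  set Q := V * (4 * (A * B * B)) with hQ
  have hQ0 : 0 ≤ Q := by positivity
  refine ⟨(Q + 1) / 2 + (p + 1).factorial * M, by positivity, fun n hn => ?_⟩
  have n0 : (0 : ℝ) < n := by exact_mod_cast hn
  set σ : ℝ := ((p + 1).factorial : ℝ) * ∑' j, r j ^ (p + 1) with hσ
  set G : Ω → ℝ := fun ω => GG p n r (fun l => X l ω) with hG
  set m : ℝ := ∫ ω, G ω ∂P with hmdef
  have aG : AllLp P G := g.GG_allLp p n
  set w : ℝ := (n : ℝ) ^ φ with hw
  have w0 : 0 < w := Real.rpow_pos_of_pos n0 _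
  -- variance
  have var : ∫ ω, (G ω - m) ^ 2 ∂P ≤ Q * w ^ 2 := by
    refine (hV n).trans ?_
    have F := four_all (Finset.Icc (1 : ℤ) n) (fun i j => |r (j - i)|) p (A * (n : ℝ) ^ e)
      (B * (n : ℝ) ^ f) (fun _ _ => abs_nonneg _)
      (fun i j => by rw [← g.r_symm, neg_sub]) (by positivity) (hA n hn) (hB n hn)
    have cI : ((Finset.Icc (1 : ℤ) n).card : ℝ) = n := by simp
    rw [cI] at F
    calc _ ≤ V * ((n : ℝ)⁻¹ * (n : ℝ)⁻¹ * (4 * ((n : ℝ) * (A * (n : ℝ) ^ e * (B * (n : ℝ) ^ f) *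
          (B * (n : ℝ) ^ f))))) := by gcongr
      _ = Q * (n : ℝ) ^ (-1 + e + 2 * f) := by
        rw [Real.rpow_add n0, Real.rpow_add n0, two_mul, Real.rpow_add n0, Real.rpow_neg_one]
        field_simp
        rw [hQ]; ring
      _ ≤ Q * (n : ℝ) ^ (2 * φ) := by
        gcongr
        exact_mod_cast hn
      _ = _ := by
        rw [mul_comm 2 φ, Real.rpow_mul n0.le, hw]; norm_cast
  have mean : |m - (σ.toNNReal : ℝ)| ≤ (p + 1).factorial * M * w := by
    have hm0 : 0 ≤ m := g.intGG_nonneg p n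
    have h1 : |m - (σ.toNNReal : ℝ)| ≤ |m - σ| := by
      rw [Real.coe_toNNReal']
      have := abs_max_sub_max_le_abs m σ 0
      rwa [max_eq_left hm0] at this
    refine h1.trans ?_
    have h2 : m = _ := g.intGG p n
    rw [h2, hσ, ← mul_sub, abs_mul, Nat.abs_cast, mul_assoc]
    have := hM n hn
    rw [neg_neg] at this
    gcongr
  have iG : Integrable (fun ω => (G ω - m) ^ 2) P := by
    simp only [pow_two]
    exact ((aG.sub (AllLp.const _)).mul (aG.sub (AllLp.const _))).integrable
  calc ∫ ω, |G ω - σ.toNNReal| ∂P ≤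
      ∫ ω, ((w⁻¹ / 2) * (G ω - m) ^ 2 + (w / 2 + |m - (σ.toNNReal : ℝ)|)) ∂P := by
        refine integral_mono ((aG.sub (AllLp.const _)).abs.integrable)
          ((iG.const_mul _).add (integrable_const _)) fun ω => ?_
        have t1 : |G ω - (σ.toNNReal : ℝ)| ≤ |G ω - m| + |m - (σ.toNNReal : ℝ)| := abs_sub_le _ _ _
        have t2 : |G ω - m| ≤ (w⁻¹ / 2) * (G ω - m) ^ 2 + w / 2 := by
          rw [← sq_abs (G ω - m)]
          set z := |G ω - m|
          have : (w⁻¹ / 2) * z ^ 2 + w / 2 - z = (w⁻¹ / 2) * (z - w) ^ 2 := by field_simp; ring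
          have : 0 ≤ (w⁻¹ / 2) * (z - w) ^ 2 := by positivity
          linarith
        show |G ω - (σ.toNNReal : ℝ)| ≤ _
        linarith
    _ = (w⁻¹ / 2) * ∫ ω, (G ω - m) ^ 2 ∂P + (w / 2 + |m - (σ.toNNReal : ℝ)|) := by
        rw [integral_add (iG.const_mul _) (integrable_const _), integral_const_mul]
        simp
    _ ≤ (w⁻¹ / 2) * (Q * w ^ 2) + (w / 2 + (p + 1).factorial * M * w) := by
        gcongr
    _ = _ := by field_simp; ring

theorem stmt13
    {Ω : Type} [MeasureSpace Ω] [IsProbabilityMeasure (ℙ : Measure Ω)]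
    (H : ℝ) (hH0 : 0 < H) (hH1 : H < 1)
    (X : ℤ → Ω → ℝ) (hXmeas : ∀ k, Measurable (X k))
    (hGauss : ∀ (s : Finset ℤ) (c : ℤ → ℝ), ∃ v : ℝ≥0,
      Measure.map (fun ω => ∑ k ∈ s, c k * X k ω) ℙ = gaussianReal 0 v)
    (hr : ∀ k j : ℤ, ∫ ω, X k ω * X (k + j) ω = rH H j)
    (q : ℕ) (hq : 2 ≤ q) (hHq : H < 1 - 1 / (2 * (q : ℝ))) :
    ∃ C : ℝ, 0 < C ∧ ∀ n : ℕ, 1 ≤ n → ∀ h : ℝ → ℝ, ContDiff ℝ 2 h →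
      ∀ C2 : ℝ, (∀ x, |iteratedDeriv 2 h x| ≤ C2) →
      |(∫ ω, h (S1 q X n ω)) -
        ∫ x, h x ∂(gaussianReal 0 ((q.factorial : ℝ) * ∑' j : ℤ, rH H j ^ q).toNNReal)| ≤
        C * C2 *
          (if 2 * H - 2 ≤ -1 then (n : ℝ) ^ (-(1 : ℝ) / 2)
           else if 2 * H - 2 ≤ -(1 : ℝ) / ((q : ℝ) - 1) then (n : ℝ) ^ ((2 * H - 2) / 2)
           else (n : ℝ) ^ (((2 * H - 2) * q + 1) / 2)) := by
  have g : GP X (rH H) (ℙ : Measure Ω) := by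
    refine ⟨hXmeas, hGauss, fun k l => ?_, rH_zero H hH0⟩
    have := hr k (l - k)
    rwa [add_sub_cancel] at this
  obtain ⟨K, b, hdec, hb1, hb2⟩ := rH_decay H hH0 hH1
  set φ : ℝ := if 2 * H - 2 ≤ -1 then -(1 : ℝ) / 2
           else if 2 * H - 2 ≤ -(1 : ℝ) / ((q : ℝ) - 1) then (2 * H - 2) / 2
           else ((2 * H - 2) * q + 1) / 2 with hφ
  obtain ⟨⟨f1, f2, f3⟩, e, f, he, hf, hef⟩ := exps H b hH0 hH1 q hq hHq hb1 hb2 φ hφ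
  have hrate : ∀ n : ℕ, (if 2 * H - 2 ≤ -1 then (n : ℝ) ^ (-(1 : ℝ) / 2)
           else if 2 * H - 2 ≤ -(1 : ℝ) / ((q : ℝ) - 1) then (n : ℝ) ^ ((2 * H - 2) / 2)
           else (n : ℝ) ^ (((2 * H - 2) * q + 1) / 2)) = (n : ℝ) ^ φ := by
    intro n; rw [hφ]; split_ifs <;> rfl
  simp only [hrate]
  clear_value φ
  clear hφ hrate
  obtain ⟨p, rfl⟩ : ∃ p, q = p + 1 := ⟨q - 1, by omega⟩
  obtain ⟨C, hC0, hC⟩ := g.final p K b φ e f hdec f1 f2 f3 he (by simpa using hf) hef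
  refine ⟨2 * C, by positivity, fun n hn h hh C2 hC2 => ?_⟩
  have hC20 : 0 ≤ C2 := (abs_nonneg _).trans (hC2 0)
  have h2eq : iteratedDeriv 2 h = deriv (deriv h) := by
    rw [iteratedDeriv_succ, iteratedDeriv_one]
  have cd1 : ContDiff ℝ 1 (deriv h) := by
    have : ContDiff ℝ (1 + 1) h := by exact_mod_cast hh
    exact (contDiff_succ_iff_deriv.1 this).2.2
  have key := smart_path (P := (ℙ : Measure Ω)) (fun ω => FF p n (fun l => X l ω))
    (fun ω => GG p n (rH H) (fun l => X l ω)) ((FF_meas p n).comp g.meas_path)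
    ((GG_meas p n _).comp g.meas_path) (g.FF_allLp p n) (g.GG_allLp p n)
    (((p + 1).factorial : ℝ) * ∑' j : ℤ, rH H j ^ (p + 1)).toNNReal
    (fun u u' c => g.stein p n u u' c)
    h (deriv h) (iteratedDeriv 2 h) C2
    (fun x => (hh.differentiable (by norm_num) x).hasDerivAt)
    (fun x => by rw [h2eq]; exact (cd1.differentiable (by norm_num) x).hasDerivAt)
    (by rw [h2eq]; exact cd1.continuous_deriv (by norm_num)) hC2
  refine le_trans key ?_
  have := hC n hn
  calc _ ≤ 2 * C2 * (C * (n : ℝ) ^ φ) := by gcongr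
    _ = _ := by ring
end

section
/- Let F ~ N(0,γ²) and Z ~ N(0,σ²) with γ, σ > 0. For every function h : ℝ → ℝ that is twice continuously differentiable with bounded second derivative, |E[h(F)] − E[h(Z)]| ≤ (‖h''‖_∞/2)·|σ² − γ²|. -/
open MeasureTheory ProbabilityTheory
open scoped NNReal

lemma taylor_aux (h : ℝ → ℝ) (hh : ContDiff ℝ 2 h) (C : ℝ) (hC : ∀ x, |iteratedDeriv 2 h x| ≤ C)
    (x y : ℝ) : |h (x + y) - h x - deriv h x * y| ≤ C / 2 * y ^ 2 := by
  have hd : Differentiable ℝ h := hh.differentiable (by norm_num)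
  have hd2 : Differentiable ℝ (deriv h) := by
    have := hh.differentiable_iteratedDeriv 1 (by norm_num)
    simpa [iteratedDeriv_one] using this
  have hL : ∀ u v, |deriv h v - deriv h u| ≤ C * |v - u| := by
    intro u v
    have := Convex.norm_image_sub_le_of_norm_deriv_le (f := deriv h) (C := C) (s := Set.univ)
      (x := u) (y := v) (fun z _ => hd2 z)
      (fun z _ => by simpa [iteratedDeriv_succ, iteratedDeriv_zero] using hC z)
      convex_univ trivial trivial
    simpa using this
  have hg : ∀ t : ℝ, HasDerivAt (fun t : ℝ => h (x + t * y) - h x - deriv h x * (t * y))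
      (deriv h (x + t * y) * y - deriv h x * y) t := by
    intro t
    have h1 : HasDerivAt (fun t : ℝ => t * y) y t := by
      simpa using (hasDerivAt_id t).mul_const y
    have h2 := (hd (x + t * y)).hasDerivAt.comp t (h1.const_add x)
    exact (h2.sub_const (h x)).sub (h1.const_mul (deriv h x))
  have hB : ∀ t : ℝ, HasDerivAt (fun t : ℝ => C / 2 * y ^ 2 * t ^ 2) (C * y ^ 2 * t) t := by
    intro t
    have := (hasDerivAt_pow 2 t).const_mul (C / 2 * y ^ 2)
    have e : C * y ^ 2 * t = C / 2 * y ^ 2 * (((2 : ℕ) : ℝ) * t ^ (2 - 1)) := by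
      norm_num; ring
    rw [e]; exact this
  have key := image_norm_le_of_norm_deriv_right_le_deriv_boundary (a := 0) (b := 1)
    (f := fun t : ℝ => h (x + t * y) - h x - deriv h x * (t * y))
    (fun t _ => (hg t).continuousAt.continuousWithinAt)
    (fun t _ => (hg t).hasDerivWithinAt)
    (B := fun t : ℝ => C / 2 * y ^ 2 * t ^ 2) (by simp) hB
    (by
      intro t ht
      rw [← sub_mul, Real.norm_eq_abs, abs_mul]
      have := hL x (x + t * y)
      have h3 : |x + t * y - x| = t * |y| := by
        rw [add_sub_cancel_left, abs_mul, abs_of_nonneg ht.1]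
      rw [h3] at this
      calc _ ≤ C * (t * |y|) * |y| := by gcongr
        _ = C * y ^ 2 * t := by rw [← sq_abs y]; ring)
    (x := 1) (by simp)
  simpa using key

lemma integrable_aux (h : ℝ → ℝ) (hh : ContDiff ℝ 2 h) (C : ℝ)
    (hC : ∀ x, |iteratedDeriv 2 h x| ≤ C) (v : ℝ≥0) (x : ℝ) :
    Integrable (fun y => h (x + y)) (gaussianReal 0 v) := by
  have i1 : Integrable (fun y : ℝ => y) (gaussianReal 0 v) :=
    (memLp_id_gaussianReal 1).integrable (by simp)
  have i2 : Integrable (fun y : ℝ => y ^ 2) (gaussianReal 0 v) :=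
    (memLp_id_gaussianReal 2).integrable_sq
  have i3 : Integrable (fun y => h (x + y) - h x - deriv h x * y) (gaussianReal 0 v) := by
    refine (i2.const_mul (C / 2)).mono' ?_ (.of_forall fun y => taylor_aux h hh C hC x y)
    have := hh.continuous
    exact Continuous.aestronglyMeasurable (by fun_prop)
  have := (i3.add (i1.const_mul (deriv h x))).add (integrable_const (h x))
  refine this.congr (.of_forall fun y => ?_)
  simp

lemma step_aux (h : ℝ → ℝ) (hh : ContDiff ℝ 2 h) (C : ℝ)
    (hC : ∀ x, |iteratedDeriv 2 h x| ≤ C) (v : ℝ≥0) (x : ℝ) :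
    |(∫ y, h (x + y) ∂gaussianReal 0 v) - h x| ≤ C / 2 * v := by
  have i1 : Integrable (fun y : ℝ => y) (gaussianReal 0 v) :=
    (memLp_id_gaussianReal 1).integrable (by simp)
  have i2 : Integrable (fun y : ℝ => y ^ 2) (gaussianReal 0 v) :=
    (memLp_id_gaussianReal 2).integrable_sq
  have i0 := integrable_aux h hh C hC v x
  have e2 : ∫ y : ℝ, y ^ 2 ∂gaussianReal 0 v = v := by
    have := variance_fun_id_gaussianReal (μ := 0) (v := v)
    rwa [variance_of_integral_eq_zero (by fun_prop) (by simp)] at this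
  have e : (∫ y, h (x + y) ∂gaussianReal 0 v) - h x
      = ∫ y, (h (x + y) - h x - deriv h x * y) ∂gaussianReal 0 v := by
    have i4 : Integrable (fun y => h (x + y) - h x) (gaussianReal 0 v) :=
      i0.sub (integrable_const _)
    rw [integral_sub i4 (i1.const_mul _),
      integral_sub i0 (integrable_const _), integral_const_mul]
    simp
  rw [e, ← e2, ← integral_const_mul]
  exact norm_integral_le_of_norm_le (f := fun y => h (x + y) - h x - deriv h x * y)
    (i2.const_mul (C / 2)) (.of_forall fun y => taylor_aux h hh C hC x y)

lemma main_aux (h : ℝ → ℝ) (hh : ContDiff ℝ 2 h) (C : ℝ)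
    (hC : ∀ x, |iteratedDeriv 2 h x| ≤ C) (a v : ℝ≥0) :
    |(∫ y, h y ∂gaussianReal 0 (a + v)) - ∫ y, h y ∂gaussianReal 0 a| ≤ C / 2 * v := by
  have hI : ∀ w, Integrable h (gaussianReal 0 w) := fun w => by
    simpa using integrable_aux h hh C hC w 0
  have hc : gaussianReal 0 (a + v) = (gaussianReal 0 a).conv (gaussianReal 0 v) := by
    rw [gaussianReal_conv_gaussianReal]; simp
  have hi := hI (a + v)
  rw [hc] at hi ⊢
  rw [integral_conv hi]
  have hp : Integrable (fun p : ℝ × ℝ => h (p.1 + p.2))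
      ((gaussianReal 0 a).prod (gaussianReal 0 v)) := by
    rw [Measure.conv] at hi
    exact hi.comp_measurable (by fun_prop)
  rw [← integral_sub hp.integral_prod_left (hI a)]
  have := norm_integral_le_of_norm_le_const (μ := gaussianReal 0 a)
    (f := fun x => (∫ y, h (x + y) ∂gaussianReal 0 v) - h x) (C := C / 2 * v)
    (.of_forall fun x => step_aux h hh C hC v x)
  simpa using this

/-- comparison of two centered Gaussian laws against a C² test function with
bounded second derivative: |E[h(F)] - E[h(Z)]| <= (||h''||_inf / 2) |sigma^2 - gamma^2|
for F ~ N(0, gamma^2) and Z ~ N(0, sigma^2). -/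
theorem stmt14 (γ σ : ℝ) (hγ : 0 < γ) (hσ : 0 < σ)
    (h : ℝ → ℝ) (hh : ContDiff ℝ 2 h) (C : ℝ) (hC : ∀ x, |iteratedDeriv 2 h x| ≤ C) :
    |(∫ x, h x ∂(gaussianReal 0 (γ ^ 2).toNNReal)) -
      ∫ x, h x ∂(gaussianReal 0 (σ ^ 2).toNNReal)| ≤ C / 2 * |σ ^ 2 - γ ^ 2| := by
  have key : ∀ a b : ℝ, 0 ≤ a → a ≤ b →
      |(∫ x, h x ∂(gaussianReal 0 b.toNNReal)) -
        ∫ x, h x ∂(gaussianReal 0 a.toNNReal)| ≤ C / 2 * |b - a| := by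
    intro a b ha hab
    have := main_aux h hh C hC a.toNNReal (b - a).toNNReal
    rw [← Real.toNNReal_add ha (sub_nonneg.2 hab), add_sub_cancel,
      Real.coe_toNNReal _ (sub_nonneg.2 hab)] at this
    rwa [abs_of_nonneg (sub_nonneg.2 hab)]
  rcases le_total (γ ^ 2) (σ ^ 2) with hle | hle
  · rw [abs_sub_comm]
    exact key _ _ (sq_nonneg _) hle
  · rw [abs_sub_comm (σ ^ 2)]
    exact key _ _ (sq_nonneg _) hle
end

section
/- Let F ~ N(0,γ²) and Z ~ N(0,σ²) with γ, σ > 0. For every Lipschitz function h : ℝ → ℝ with Lipschitz constant L, |E[h(F)] − E[h(Z)]| ≤ (L/max(σ,γ))·|σ² − γ²|. -/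
open MeasureTheory ProbabilityTheory
open scoped NNReal

lemma aux_map (c : ℝ) (h : ℝ → ℝ) (hc : Continuous h) :
    ∫ x, h x ∂(gaussianReal 0 (c ^ 2).toNNReal) = ∫ x, h (c * x) ∂(gaussianReal 0 1) := by
  have e : gaussianReal 0 (c ^ 2).toNNReal = (gaussianReal 0 1).map (c * ·) := by
    rw [gaussianReal_map_const_mul]
    congr 1
    · simp
    · ext; simp [sq_nonneg]
  rw [e, integral_map (by fun_prop) hc.aestronglyMeasurable]

lemma aux_int_sq : Integrable (fun x : ℝ => x ^ 2) (gaussianReal 0 1) :=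
  (memLp_id_gaussianReal (μ := 0) (v := 1) 2).integrable_sq

lemma aux_int_id : Integrable (fun x : ℝ => x) (gaussianReal 0 1) :=
  (memLp_id_gaussianReal (μ := 0) (v := 1) 1).integrable (by simp)

lemma aux_sq : ∫ x : ℝ, x ^ 2 ∂(gaussianReal 0 1) = 1 := by
  have h := variance_fun_id_gaussianReal (μ := 0) (v := 1)
  rw [variance_of_integral_eq_zero (by fun_prop) integral_id_gaussianReal] at h
  simpa using h

lemma aux_abs : ∫ x : ℝ, |x| ∂(gaussianReal 0 1) ≤ 1 := by
  calc ∫ x : ℝ, |x| ∂(gaussianReal 0 1)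
      ≤ ∫ x : ℝ, (1 + x ^ 2) / 2 ∂(gaussianReal 0 1) := by
        apply integral_mono aux_int_id.abs
        · exact ((integrable_const 1).add aux_int_sq).div_const 2
        · intro x
          have := sq_nonneg (|x| - 1)
          have h2 := sq_abs x
          simp only
          nlinarith
    _ = 1 := by
        rw [integral_div, integral_add (integrable_const 1) aux_int_sq, aux_sq]
        simp

lemma aux_int (c : ℝ) (h : ℝ → ℝ) (L : ℝ≥0) (hh : LipschitzWith L h) :
    Integrable (fun x => h (c * x)) (gaussianReal 0 1) := by
  have hc := hh.continuous
  refine Integrable.mono' (g := fun x => |h 0| + L * (|c| * |x|)) ?_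
    (by fun_prop) (Filter.Eventually.of_forall fun x => ?_)
  · exact (integrable_const _).add ((aux_int_id.abs.const_mul _).const_mul _)
  · have := hh.dist_le_mul (c * x) 0
    rw [Real.dist_eq, Real.dist_eq, sub_zero, abs_mul] at this
    rw [Real.norm_eq_abs]
    have := abs_sub_abs_le_abs_sub (h (c * x)) (h 0)
    linarith

/-- comparison of two centered Gaussian laws against a Lipschitz test function:
|E[h(F)] - E[h(Z)]| <= (L / max(sigma, gamma)) |sigma^2 - gamma^2| for F ~ N(0, gamma^2),
Z ~ N(0, sigma^2) and h Lipschitz with constant L. -/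
theorem stmt15 (γ σ : ℝ) (hγ : 0 < γ) (hσ : 0 < σ)
    (h : ℝ → ℝ) (L : ℝ≥0) (hh : LipschitzWith L h) :
    |(∫ x, h x ∂(gaussianReal 0 (γ ^ 2).toNNReal)) -
      ∫ x, h x ∂(gaussianReal 0 (σ ^ 2).toNNReal)| ≤
      (L : ℝ) / max σ γ * |σ ^ 2 - γ ^ 2| := by
  rw [aux_map γ h hh.continuous, aux_map σ h hh.continuous,
    ← integral_sub (aux_int γ h L hh) (aux_int σ h L hh)]
  have hm : 0 < max σ γ := lt_max_of_lt_left hσ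
  calc |∫ x, h (γ * x) - h (σ * x) ∂(gaussianReal 0 1)|
      ≤ ∫ x, |h (γ * x) - h (σ * x)| ∂(gaussianReal 0 1) := abs_integral_le_integral_abs
    _ ≤ ∫ x, L * |σ - γ| * |x| ∂(gaussianReal 0 1) := by
        apply integral_mono ((aux_int γ h L hh).sub (aux_int σ h L hh)).abs
          (aux_int_id.abs.const_mul _)
        intro x
        have := hh.dist_le_mul (γ * x) (σ * x)
        rw [Real.dist_eq, Real.dist_eq, ← sub_mul, abs_mul, abs_sub_comm γ σ, ← mul_assoc] at this
        exact this
    _ = L * |σ - γ| * ∫ x, |x| ∂(gaussianReal 0 1) := integral_const_mul _ _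
    _ ≤ L * |σ - γ| * 1 := by
        gcongr
        exact aux_abs
    _ ≤ (L : ℝ) / max σ γ * |σ ^ 2 - γ ^ 2| := by
        have e : |σ ^ 2 - γ ^ 2| = |σ - γ| * (σ + γ) := by
          rw [← abs_of_pos (add_pos hσ hγ), ← abs_mul]
          congr 1
          ring
        have hle : max σ γ ≤ σ + γ := max_le (by linarith) (by linarith)
        rw [e, mul_one, div_mul_eq_mul_div, le_div_iff₀ hm, ← mul_assoc]
        gcongr
end
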